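/- Let V be an irreducible Harish-Chandra module over τ(B) whose weight-space dimensions are not uniformly bounded. Then V is a highest weight module: there exist a subgroup M of ℤ^n and β ∈ ℤ^n with ℤ^n = M ⊕ ℤβ and a nonzero vector v ∈ V such that τ(B)^+_M·v = 0 and U(τ(B))·v = V; equivalently, V is isomorphic to the unique irreducible quotient 𝕃_{τ(B)}(X, β, M) of a generalized Verma module for some irreducible τ(B)_M-module X. -/

import Mathlib

open scoped TensorProduct

namespace MT

/-- Presentation of the full toroidal Lie algebra `τ` of rank `n` associated with the
finite-dimensional simple complex Lie algebra `𝔤`, the invariant form `κ` and the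
2-cocycle `φ = c₁ • φ₁ + c₂ • φ₂`.  Here `E m x` stands for `x ⊗ t^m`, `K m i` for
`t^m K_i` (the image in the space of Kähler differentials `𝒦 = Ω/dA_n`), and
`W m i` for `t^m d_i`. -/
structure IsFullToroidal (n : ℕ) (𝔤 : Type) [LieRing 𝔤] [LieAlgebra ℂ 𝔤]
    (τ : Type) [LieRing τ] [LieAlgebra ℂ τ]
    (κ : 𝔤 →ₗ[ℂ] 𝔤 →ₗ[ℂ] ℂ) (c₁ c₂ : ℂ)
    (E : (Fin n → ℤ) → 𝔤 →ₗ[ℂ] τ) (K W : (Fin n → ℤ) → Fin n → τ) : Prop where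
  κ_symm : ∀ x y, κ x y = κ y x
  κ_invariant : ∀ x y z, κ ⁅x, y⁆ z = κ x ⁅y, z⁆
  κ_nondeg : ∀ x, (∀ y, κ x y = 0) → x = 0
  span_eq_top : Submodule.span ℂ
      ({z : τ | ∃ m x, z = E m x} ∪ {z : τ | ∃ m i, z = K m i} ∪
        {z : τ | ∃ m i, z = W m i}) = ⊤
  K_rel : ∀ m : Fin n → ℤ, (∑ i, (m i : ℂ) • K m i) = 0
  lie_E_E : ∀ m k x y, ⁅E m x, E k y⁆
      = E (m + k) ⁅x, y⁆ + κ x y • ∑ i, (m i : ℂ) • K (m + k) i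
  lie_E_K : ∀ m x k j, ⁅E m x, K k j⁆ = 0
  lie_K_K : ∀ m i k j, ⁅K m i, K k j⁆ = 0
  lie_W_E : ∀ m i k x, ⁅W m i, E k x⁆ = (k i : ℂ) • E (m + k) x
  lie_W_K : ∀ m i k j, ⁅W m i, K k j⁆
      = (k i : ℂ) • K (m + k) j + (if i = j then ∑ p, (m p : ℂ) • K (m + k) p else 0)
  lie_W_W : ∀ m i k j, ⁅W m i, W k j⁆
      = (k i : ℂ) • W (m + k) j - (m j : ℂ) • W (m + k) i
        + (c₁ * (-((k i : ℂ) * (m j : ℂ))) + c₂ * ((m i : ℂ) * (k j : ℂ)))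
          • ∑ p, (m p : ℂ) • K (m + k) p

/-- The map algebra `τ(B) = τ ⊗ B` is a complex Lie algebra. -/
noncomputable instance mapLieAlgebra (B τ : Type) [CommRing B] [Algebra ℂ B]
    [LieRing τ] [LieAlgebra ℂ τ] : LieAlgebra ℂ (B ⊗[ℂ] τ) :=
  { (inferInstance : Module ℂ (B ⊗[ℂ] τ)) with
    lie_smul := fun c x y => by
      rw [← algebraMap_smul B c y, lie_smul, algebraMap_smul] }

/-- The simultaneous eigenspace ("weight space") of the commuting family of
operators `d` for the eigenvalue function `l`. -/
def weightSpace {n : ℕ} {L V : Type*} [LieRing L] [LieAlgebra ℂ L] [AddCommGroup V]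
    [Module ℂ V] [LieRingModule L V] [LieModule ℂ L V]
    (d : Fin n → L) (l : Fin n → ℂ) : Submodule ℂ V where
  carrier := {v | ∀ i, ⁅d i, v⁆ = l i • v}
  add_mem' := by
    intro a b ha hb i
    rw [lie_add, ha i, hb i, smul_add]
  zero_mem' := by
    intro i
    rw [lie_zero, smul_zero]
  smul_mem' := by
    intro c a ha i
    rw [lie_smul, ha i, smul_comm]

/-- `V` is a Harish-Chandra module with respect to the degree operators `d`:
the sum of the weight spaces is all of `V` and each weight space is finite
dimensional. -/
def IsHarishChandra {n : ℕ} {L V : Type*} [LieRing L] [LieAlgebra ℂ L] [AddCommGroup V]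
    [Module ℂ V] [LieRingModule L V] [LieModule ℂ L V] (d : Fin n → L) : Prop :=
  (⨆ l : Fin n → ℂ, weightSpace (V := V) d l) = ⊤ ∧
    ∀ l : Fin n → ℂ, FiniteDimensional ℂ (weightSpace (V := V) d l)

/-- `V` is cuspidal (uniformly bounded): a Harish-Chandra module whose weight
space dimensions admit a uniform bound. -/
def IsCuspidal {n : ℕ} {L V : Type*} [LieRing L] [LieAlgebra ℂ L] [AddCommGroup V]
    [Module ℂ V] [LieRingModule L V] [LieModule ℂ L V] (d : Fin n → L) : Prop :=
  IsHarishChandra (V := V) d ∧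
    ∃ N : ℕ, ∀ l : Fin n → ℂ, Module.finrank ℂ (weightSpace (V := V) d l) ≤ N

/-- The degree operators `d_i ⊗ 1` inside `τ(B)`. -/
noncomputable def dOp {n : ℕ} (B : Type) [CommRing B] [Algebra ℂ B] {τ : Type}
    [LieRing τ] [LieAlgebra ℂ τ] (W : (Fin n → ℤ) → Fin n → τ) (i : Fin n) :
    B ⊗[ℂ] τ :=
  (1 : B) ⊗ₜ[ℂ] W 0 i

variable {n : ℕ} {𝔤 : Type} [LieRing 𝔤] [LieAlgebra ℂ 𝔤]
variable {τ : Type} [LieRing τ] [LieAlgebra ℂ τ]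

/-- The set of homogeneous generators of `τ` of degree `m`. -/
def genOfDeg (E : (Fin n → ℤ) → 𝔤 →ₗ[ℂ] τ) (K W : (Fin n → ℤ) → Fin n → τ)
    (m : Fin n → ℤ) : Set τ :=
  Set.range (E m) ∪ Set.range (K m) ∪ Set.range (W m)

/-- The homogeneous generators of `τ` of degree lying in the subgroup `M`,
i.e. generators of `τ_M`. -/
def tauMGens (E : (Fin n → ℤ) → 𝔤 →ₗ[ℂ] τ) (K W : (Fin n → ℤ) → Fin n → τ)
    (M : AddSubgroup (Fin n → ℤ)) : Set τ :=
  {Y | ∃ m ∈ M, Y ∈ genOfDeg E K W m}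

/-- The graded piece `τ_m`. -/
def gradedPiece (E : (Fin n → ℤ) → 𝔤 →ₗ[ℂ] τ) (K W : (Fin n → ℤ) → Fin n → τ)
    (m : Fin n → ℤ) : Submodule ℂ τ :=
  Submodule.span ℂ (genOfDeg E K W m)

/-- The subalgebra `τ(B)_M = ⊕_{m ∈ M} τ_m ⊗ B` of `τ(B)`. -/
noncomputable def tauBM (B : Type) [CommRing B] [Algebra ℂ B]
    (E : (Fin n → ℤ) → 𝔤 →ₗ[ℂ] τ) (K W : (Fin n → ℤ) → Fin n → τ)
    (M : AddSubgroup (Fin n → ℤ)) : LieSubalgebra ℂ (B ⊗[ℂ] τ) :=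
  LieSubalgebra.lieSpan ℂ (B ⊗[ℂ] τ)
    {z | ∃ (a : B) (Y : τ), Y ∈ tauMGens E K W M ∧ z = a ⊗ₜ[ℂ] Y}

/-- The degree operators `d_i ⊗ 1` as elements of `τ(B)_M` (note `0 ∈ M`). -/
noncomputable def dOpM (B : Type) [CommRing B] [Algebra ℂ B]
    (E : (Fin n → ℤ) → 𝔤 →ₗ[ℂ] τ) (K W : (Fin n → ℤ) → Fin n → τ)
    (M : AddSubgroup (Fin n → ℤ)) (i : Fin n) : ↥(tauBM B E K W M) :=
  ⟨(1 : B) ⊗ₜ[ℂ] W 0 i,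
    LieSubalgebra.subset_lieSpan
      ⟨1, W 0 i, ⟨0, M.zero_mem, Or.inr ⟨i, rfl⟩⟩, rfl⟩⟩

/-- `(τ ⊗ I)·V = 0`. -/
def annTensor (τ : Type) [LieRing τ] [LieAlgebra ℂ τ] (B : Type) [CommRing B]
    [Algebra ℂ B] (I : Ideal B) (V : Type) [AddCommGroup V] [Module ℂ V]
    [LieRingModule (B ⊗[ℂ] τ) V] : Prop :=
  ∀ X : τ, ∀ a ∈ I, ∀ v : V, ⁅a ⊗ₜ[ℂ] X, v⁆ = 0

/-- The action of `τ(B)` on `V` is by evaluation at the algebra homomorphism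
`ψ : B → ℂ`:  `(X ⊗ b)·v = ψ(b) (X ⊗ 1)·v`. -/
def evalActs (τ : Type) [LieRing τ] [LieAlgebra ℂ τ] (B : Type) [CommRing B]
    [Algebra ℂ B] (ψ : B →ₐ[ℂ] ℂ) (V : Type) [AddCommGroup V] [Module ℂ V]
    [LieRingModule (B ⊗[ℂ] τ) V] : Prop :=
  ∀ (X : τ) (b : B) (v : V), ⁅b ⊗ₜ[ℂ] X, v⁆ = ψ b • ⁅(1 : B) ⊗ₜ[ℂ] X, v⁆

/-- `v` is annihilated by `τ(B)^+_M = ⊕_{m ∈ M, r ≥ 1} τ(B)_{m + rβ}`. -/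
def annPlus (B : Type) [CommRing B] [Algebra ℂ B]
    (E : (Fin n → ℤ) → 𝔤 →ₗ[ℂ] τ) (K W : (Fin n → ℤ) → Fin n → τ)
    (M : AddSubgroup (Fin n → ℤ)) (β : Fin n → ℤ) {V : Type} [AddCommGroup V]
    [Module ℂ V] [LieRingModule (B ⊗[ℂ] τ) V] (v : V) : Prop :=
  ∀ m₀ ∈ M, ∀ r : ℕ, 0 < r → ∀ a : B,
    (∀ x : 𝔤, ⁅a ⊗ₜ[ℂ] E (m₀ + (r : ℤ) • β) x, v⁆ = 0) ∧
    (∀ i : Fin n, ⁅a ⊗ₜ[ℂ] K (m₀ + (r : ℤ) • β) i, v⁆ = 0) ∧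
    (∀ i : Fin n, ⁅a ⊗ₜ[ℂ] W (m₀ + (r : ℤ) • β) i, v⁆ = 0)

/-- Successive action of a list of Lie algebra elements on a module vector:
`actList [x₁, …, x_r] v = x₁ · (x₂ ⋯ (x_r · v))`. -/
def actList {L V : Type*} [LieRing L] [AddCommGroup V] [LieRingModule L V] :
    List L → V → V
  | [], v => v
  | x :: xs, v => ⁅x, actList xs v⁆

/-- `V` is a highest weight module for `τ(B)`:  there are `M ≤ ℤⁿ` and `β ∈ ℤⁿ`
with `ℤⁿ = M ⊕ ℤβ` and a nonzero `v ∈ V` with `τ(B)^+_M · v = 0` which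
generates `V` over `U(τ(B))`. -/
def IsHighestWeightModule (B : Type) [CommRing B] [Algebra ℂ B]
    (E : (Fin n → ℤ) → 𝔤 →ₗ[ℂ] τ) (K W : (Fin n → ℤ) → Fin n → τ)
    (V : Type) [AddCommGroup V] [Module ℂ V] [LieRingModule (B ⊗[ℂ] τ) V]
    [LieModule ℂ (B ⊗[ℂ] τ) V] : Prop :=
  ∃ (M : AddSubgroup (Fin n → ℤ)) (β : Fin n → ℤ),
    IsCompl M (AddSubgroup.zmultiples β) ∧
    ∃ v : V, v ≠ 0 ∧ annPlus B E K W M β v ∧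
      LieSubmodule.lieSpan ℂ (B ⊗[ℂ] τ) {v} = ⊤

/-- Linear independence properties of the generators of the full toroidal Lie
algebra: the only linear relations among the homogeneous generators are the
Kähler relations `∑ᵢ mᵢ t^m K_i = 0`. -/
structure FreeGens (E : (Fin n → ℤ) → 𝔤 →ₗ[ℂ] τ) (K W : (Fin n → ℤ) → Fin n → τ) :
    Prop where
  K_indep : ∀ (m : Fin n → ℤ) (c : Fin n → ℂ), (∑ i, c i • K m i) = 0 →
      ∃ t : ℂ, ∀ i, c i = t * (m i : ℂ)
  W_indep : ∀ (m : Fin n → ℤ) (c : Fin n → ℂ), (∑ i, c i • W m i) = 0 → ∀ i, c i = 0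
  E_inj : ∀ (m : Fin n → ℤ) (x : 𝔤), E m x = 0 → x = 0
  EKW_indep : ∀ (m : Fin n → ℤ) (x : 𝔤) (c d : Fin n → ℂ),
      E m x + (∑ i, c i • K m i) + (∑ i, d i • W m i) = 0 →
      x = 0 ∧ (∀ i, d i = 0) ∧ ∃ t : ℂ, ∀ i, c i = t * (m i : ℂ)
  graded_indep : ∀ m : Fin n → ℤ,
      gradedPiece E K W m ⊓ (⨆ k : Fin n → ℤ, ⨆ _ : k ≠ m, gradedPiece E K W k) = ⊥

/-- A `ℤⁿ`-grading of `τ` by the degree operators `d`, with homogeneous pieces spanned by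
uniformly many elements, such that `[τ_m, τ_k] = τ_{m+k}` whenever `m ≠ k`, and such that every
combination of degree operators orthogonal to `q` extends to a copy of the semidirect product of
`ℂ[t^{±1}]` and the Witt algebra supported on the line `ℤq`. -/
structure IsDegreeGrading (P : (Fin n → ℤ) → Submodule ℂ τ) (d : Fin n → τ) (γ : ℕ) : Prop where
  lie_mem : ∀ m k X Y, X ∈ P m → Y ∈ P k → ⁅X, Y⁆ ∈ P (m + k)
  le_span_lie : ∀ m k, m ≠ k →
    P (m + k) ≤ Submodule.span ℂ {Z | ∃ X ∈ P m, ∃ Y ∈ P k, Z = ⁅X, Y⁆}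
  iSup_eq_top : ⨆ k, P k = ⊤
  d_mem : ∀ i, d i ∈ P 0
  lie_d : ∀ i k, ∀ X ∈ P k, ⁅d i, X⁆ = (k i : ℂ) • X
  exists_gens : ∀ k, ∃ g : Fin γ → τ, Submodule.span ℂ (Set.range g) = P k
  exists_line : ∀ q : Fin n → ℤ, q ≠ 0 → ∀ w : Fin n → ℂ, ∑ i, w i * (q i : ℂ) = 0 →
    ∃ L J : ℤ → τ, (∀ x, L x ∈ P (x • q)) ∧ (∀ x, J x ∈ P (x • q)) ∧
      (∀ x y, ⁅L x, J y⁆ = (y : ℂ) • J (x + y)) ∧ (∀ x y, ⁅J x, J y⁆ = 0) ∧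
      J 0 = ∑ i, w i • d i

lemma tmul_lie_tmul_lie {B : Type} [CommRing B] [Algebra ℂ B] {V : Type} [AddCommGroup V]
    [LieRingModule (B ⊗[ℂ] τ) V] (a b : B) (X Y : τ) (v : V) :
    ⁅a ⊗ₜ[ℂ] X, ⁅b ⊗ₜ[ℂ] Y, v⁆⁆ = ⁅(a * b) ⊗ₜ[ℂ] ⁅X, Y⁆, v⁆ + ⁅b ⊗ₜ[ℂ] Y, ⁅a ⊗ₜ[ℂ] X, v⁆⁆ := by
  rw [leibniz_lie]
  rfl

section Action

variable {B : Type} [CommRing B] [Algebra ℂ B]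
variable {V : Type} [AddCommGroup V] [Module ℂ V] [LieRingModule (B ⊗[ℂ] τ) V]
  [LieModule ℂ (B ⊗[ℂ] τ) V]

lemma smul_tmul_lie (c : ℂ) (b : B) (X : τ) (v : V) :
    ⁅b ⊗ₜ[ℂ] (c • X), v⁆ = c • ⁅b ⊗ₜ[ℂ] X, v⁆ := by
  rw [TensorProduct.tmul_smul, smul_lie]

/-- The action of `b ⊗ X` on `v` as a linear function of `X`. -/
noncomputable def actRight (b : B) (v : V) : τ →ₗ[ℂ] V where
  toFun X := ⁅b ⊗ₜ[ℂ] X, v⁆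
  map_add' X Y := by rw [TensorProduct.tmul_add, add_lie]
  map_smul' c X := smul_tmul_lie c b X v

@[simp] lemma actRight_apply (b : B) (v : V) (X : τ) : actRight b v X = ⁅b ⊗ₜ[ℂ] X, v⁆ := rfl

/-- The action of `b ⊗ X` on `v` as a linear function of `b`. -/
noncomputable def actLeft (X : τ) (v : V) : B →ₗ[ℂ] V where
  toFun b := ⁅b ⊗ₜ[ℂ] X, v⁆
  map_add' a b := by rw [TensorProduct.add_tmul, add_lie]
  map_smul' c b := by
    rw [← TensorProduct.smul_tmul', smul_lie, RingHom.id_apply]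

@[simp] lemma actLeft_apply (b : B) (v : V) (X : τ) : actLeft X v b = ⁅b ⊗ₜ[ℂ] X, v⁆ := rfl

/-- The weight space of weight `l + s`, for `s ∈ ℤⁿ`. -/
noncomputable def wt (B : Type) [CommRing B] [Algebra ℂ B] (V : Type) [AddCommGroup V] [Module ℂ V]
    [LieRingModule (B ⊗[ℂ] τ) V] [LieModule ℂ (B ⊗[ℂ] τ) V]
    (d : Fin n → τ) (l : Fin n → ℂ) (s : Fin n → ℤ) : Submodule ℂ V :=
  weightSpace (V := V) (fun i => (1 : B) ⊗ₜ[ℂ] d i) (fun i => l i + (s i : ℂ))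

variable {P : (Fin n → ℤ) → Submodule ℂ τ} {d : Fin n → τ} {γ : ℕ} {l : Fin n → ℂ}

lemma mem_wt {s : Fin n → ℤ} {v : V} :
    v ∈ wt B V d l s ↔ ∀ i, ⁅(1 : B) ⊗ₜ[ℂ] d i, v⁆ = (l i + (s i : ℂ)) • v := Iff.rfl

lemma IsDegreeGrading.lie_mem_wt (hP : IsDegreeGrading P d γ) {s k : Fin n → ℤ} {X : τ}
    (hX : X ∈ P k) (b : B) {v : V} (hv : v ∈ wt B V d l s) :
    ⁅b ⊗ₜ[ℂ] X, v⁆ ∈ wt B V d l (s + k) := by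
  rw [mem_wt] at hv ⊢
  intro i
  rw [tmul_lie_tmul_lie, hv i, hP.lie_d i k X hX, one_mul, smul_tmul_lie, lie_smul, ← add_smul]
  congr 1
  simp only [Pi.add_apply]
  push_cast
  ring

/-- The vector `v` is annihilated by `b ⊗ τ_k`. -/
def Kills (P : (Fin n → ℤ) → Submodule ℂ τ) (b : B) (k : Fin n → ℤ) (v : V) : Prop :=
  ∀ X ∈ P k, ⁅b ⊗ₜ[ℂ] X, v⁆ = 0

lemma IsDegreeGrading.kills_add (hP : IsDegreeGrading P d γ) {m k : Fin n → ℤ} (hmk : m ≠ k)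
    {a b : B} {v : V} (h₁ : Kills P a m v) (h₂ : Kills P b k v) : Kills P (a * b) (m + k) v := by
  have key : Submodule.span ℂ {Z | ∃ X ∈ P m, ∃ Y ∈ P k, Z = ⁅X, Y⁆} ≤
      LinearMap.ker (actRight (a * b) v) := by
    rw [Submodule.span_le]
    rintro _ ⟨X, hX, Y, hY, rfl⟩
    have := tmul_lie_tmul_lie a b X Y v
    rw [h₁ X hX, h₂ Y hY, lie_zero, lie_zero, add_zero] at this
    exact this.symm
  exact fun X hX => key (hP.le_span_lie m k hmk hX)

/-- The set of degrees `k` such that `τ(B)_k` annihilates the weight space of weight `l + s`. -/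
def killSet (B : Type) [CommRing B] [Algebra ℂ B] (V : Type) [AddCommGroup V] [Module ℂ V]
    [LieRingModule (B ⊗[ℂ] τ) V] [LieModule ℂ (B ⊗[ℂ] τ) V] (P : (Fin n → ℤ) → Submodule ℂ τ)
    (d : Fin n → τ) (l : Fin n → ℂ) (s : Fin n → ℤ) : Set (Fin n → ℤ) :=
  {k | ∀ b : B, ∀ v ∈ wt B V d l s, Kills P b k v}

lemma IsDegreeGrading.add_mem_killSet (hP : IsDegreeGrading P d γ) {s m k : Fin n → ℤ}
    (hmk : m ≠ k) (hm : m ∈ killSet B V P d l s) (hk : k ∈ killSet B V P d l s) :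
    m + k ∈ killSet B V P d l s := by
  intro b v hv
  have := hP.kills_add hmk (hm b v hv) (hk 1 v hv)
  rwa [mul_one] at this

lemma IsDegreeGrading.mem_killSet_of_wt_eq_bot (hP : IsDegreeGrading P d γ) {s k : Fin n → ℤ}
    (h : wt B V d l (s + k) = ⊥) : k ∈ killSet B V P d l s := by
  intro b v hv X hX
  have := hP.lie_mem_wt hX b hv
  rwa [h, Submodule.mem_bot] at this

/-- In nonzero degree, annihilation by `1 ⊗ τ_k` of a whole weight space suffices. -/
lemma IsDegreeGrading.mem_killSet_of_one (hP : IsDegreeGrading P d γ) {s k : Fin n → ℤ}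
    (hk : k ≠ 0) (h : ∀ v ∈ wt B V d l s, Kills P (1 : B) k v) : k ∈ killSet B V P d l s := by
  obtain ⟨i, hi⟩ := Function.ne_iff.mp hk
  intro b v hv X hX
  have h1 := tmul_lie_tmul_lie b 1 (d i) X v
  have h2 : ⁅b ⊗ₜ[ℂ] d i, v⁆ ∈ wt B V d l s := by
    simpa using hP.lie_mem_wt (hP.d_mem i) b hv
  rw [h v hv X hX, h _ h2 X hX, hP.lie_d i k X hX, lie_zero, mul_one, add_zero,
    smul_tmul_lie, eq_comm, smul_eq_zero] at h1
  exact h1.resolve_left (by exact_mod_cast hi)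

lemma IsDegreeGrading.sub_mem_killSet (hP : IsDegreeGrading P d γ) {s s' k : Fin n → ℤ}
    (hne : k ≠ s - s') (hs : k ∈ killSet B V P d l s) (hs' : k ∈ killSet B V P d l s') :
    k + (s - s') ∈ killSet B V P d l s' := by
  intro b v hv
  have key : Submodule.span ℂ {Z | ∃ X ∈ P k, ∃ Y ∈ P (s - s'), Z = ⁅X, Y⁆} ≤
      LinearMap.ker (actRight b v) := by
    rw [Submodule.span_le]
    rintro _ ⟨X, hX, Y, hY, rfl⟩
    have h1 := tmul_lie_tmul_lie b 1 X Y v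
    have h2 : ⁅(1 : B) ⊗ₜ[ℂ] Y, v⁆ ∈ wt B V d l s := by
      simpa using hP.lie_mem_wt hY 1 hv
    rw [hs' b v hv X hX, hs b _ h2 X hX, lie_zero, mul_one, add_zero] at h1
    exact h1.symm
  exact fun X hX => key (hP.le_span_lie _ _ hne hX)

/-- A subspace of an irreducible module stable under all homogeneous elements is trivial. -/
lemma IsDegreeGrading.eq_top_of_stable (hP : IsDegreeGrading P d γ)
    (hirr : LieModule.IsIrreducible ℂ (B ⊗[ℂ] τ) V) (N : Submodule ℂ V) (hN : N ≠ ⊥)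
    (h : ∀ (b : B) (k : Fin n → ℤ), ∀ X ∈ P k, ∀ v ∈ N, ⁅b ⊗ₜ[ℂ] X, v⁆ ∈ N) : N = ⊤ := by
  have hX : ∀ (b : B) (X : τ), ∀ v ∈ N, ⁅b ⊗ₜ[ℂ] X, v⁆ ∈ N := by
    intro b X v hv
    have : (⨆ k, P k) ≤ N.comap (actRight b v) := iSup_le fun k X hX => h b k X hX v hv
    rw [hP.iSup_eq_top] at this
    exact this (Submodule.mem_top (x := X))
  let N' : LieSubmodule ℂ (B ⊗[ℂ] τ) V :=
    { N with
      lie_mem := by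
        intro x v hv
        induction x using TensorProduct.induction_on with
        | zero => rw [zero_lie]; exact N.zero_mem
        | tmul b X => exact hX b X v hv
        | add x y hx hy => rw [add_lie]; exact N.add_mem hx hy }
  have hN' : N' ≠ ⊥ := by
    intro h0
    apply hN
    rw [Submodule.eq_bot_iff]
    intro v hv
    have : v ∈ N' := hv
    rwa [h0, LieSubmodule.mem_bot] at this
  have := (eq_bot_or_eq_top N').resolve_left hN'
  rw [Submodule.eq_top_iff']
  intro v
  have hv : v ∈ N' := by rw [this]; exact LieSubmodule.mem_top v
  exact hv

end Action

lemma iSupIndep_weightSpace {L V : Type*} [LieRing L] [LieAlgebra ℂ L] [AddCommGroup V]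
    [Module ℂ V] [LieRingModule L V] [LieModule ℂ L V] (d : Fin n → L)
    (hd : ∀ i j, ⁅d i, d j⁆ = 0) : iSupIndep fun l => weightSpace (V := V) d l := by
  have h := Module.End.independent_iInf_maxGenEigenspace_of_forall_mapsTo
    (fun i => LieModule.toEnd ℂ L V (d i)) (by
      intro i j φ
      apply Module.End.mapsTo_maxGenEigenspace_of_comm
      refine LinearMap.ext fun v => ?_
      change ⁅d j, ⁅d i, v⁆⁆ = ⁅d i, ⁅d j, v⁆⁆
      rw [leibniz_lie, hd, zero_lie, zero_add])
  refine h.mono fun l v hv => ?_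
  simp only [Submodule.mem_iInf]
  intro i
  apply Module.End.eigenspace_le_maxGenEigenspace
  rw [Module.End.mem_eigenspace_iff]
  exact hv i

section Module

variable {B : Type} [CommRing B] [Algebra ℂ B]
variable {V : Type} [AddCommGroup V] [Module ℂ V] [LieRingModule (B ⊗[ℂ] τ) V]
  [LieModule ℂ (B ⊗[ℂ] τ) V]
variable {P : (Fin n → ℤ) → Submodule ℂ τ} {d : Fin n → τ} {γ : ℕ} {l : Fin n → ℂ}

/-- All weights of an irreducible weight module lie in a single coset of `ℤⁿ`. -/
lemma IsDegreeGrading.exists_eq_add_of_weightSpace_ne_bot (hP : IsDegreeGrading P d γ)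
    (hirr : LieModule.IsIrreducible ℂ (B ⊗[ℂ] τ) V) (hl : wt B V d l 0 ≠ ⊥) {l' : Fin n → ℂ}
    (hl' : weightSpace (V := V) (fun i => (1 : B) ⊗ₜ[ℂ] d i) l' ≠ ⊥) :
    ∃ t : Fin n → ℤ, l' = fun i => l i + (t i : ℂ) := by
  have htop : (⨆ t, wt B V d l t) = ⊤ := by
    refine hP.eq_top_of_stable hirr _ (fun h => hl ?_) fun b k X hX v hv => ?_
    · rw [eq_bot_iff, ← h]
      exact le_iSup (fun t => wt B V d l t) 0
    · have : (⨆ t, wt B V d l t) ≤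
          (⨆ t, wt B V d l t).comap (LieModule.toEnd ℂ (B ⊗[ℂ] τ) V (b ⊗ₜ X)) :=
        iSup_le fun t v hv => Submodule.mem_iSup_of_mem (t + k) (hP.lie_mem_wt hX b hv)
      exact this hv
  by_contra! hne
  have hind := iSupIndep_weightSpace (V := V) (fun i => (1 : B) ⊗ₜ[ℂ] d i) (fun i j => by
    rw [LieAlgebra.ExtendScalars.bracket_tmul, hP.lie_d i 0 _ (hP.d_mem j)]
    simp)
  apply hl'
  have h1 := (hind l').eq_bot
  rw [eq_bot_iff, ← h1]
  refine le_inf le_rfl (le_trans le_top ?_)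
  rw [← htop]
  exact iSup_le fun t => le_iSup₂_of_le (fun i => l i + (t i : ℂ)) (hne t).symm le_rfl

/-- The vector `v` is annihilated by `τ(B)_{j + xσ}` for all large `x`. -/
def EventuallyKills (P : (Fin n → ℤ) → Submodule ℂ τ) (B : Type) [CommRing B] [Algebra ℂ B]
    [LieRingModule (B ⊗[ℂ] τ) V] (σ : Fin n → ℤ) (v : V) : Prop :=
  ∀ (b : B) (j : Fin n → ℤ), ∀ᶠ x : ℤ in Filter.atTop, Kills P b (j + x • σ) v

lemma IsDegreeGrading.eventuallyKills_of_exists (hP : IsDegreeGrading P d γ)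
    (hirr : LieModule.IsIrreducible ℂ (B ⊗[ℂ] τ) V) {σ : Fin n → ℤ} {v₀ : V} (hv₀ : v₀ ≠ 0)
    (h : EventuallyKills P B σ v₀) (v : V) : EventuallyKills P B σ v := by
  let N : Submodule ℂ V :=
    { carrier := {v | EventuallyKills P B σ v}
      add_mem' := by
        intro v w hv hw b j
        filter_upwards [hv b j, hw b j] with x h1 h2 X hX
        rw [lie_add, h1 X hX, h2 X hX, add_zero]
      zero_mem' := fun b j => Filter.Eventually.of_forall fun x X hX => lie_zero _
      smul_mem' := by
        intro c v hv b j
        filter_upwards [hv b j] with x h1 X hX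
        rw [lie_smul, h1 X hX, smul_zero] }
  have hN : N = ⊤ := by
    refine hP.eq_top_of_stable hirr N (fun h0 => hv₀ ?_) fun c k Y hY w hw b j => ?_
    · have : v₀ ∈ N := h
      rwa [h0, Submodule.mem_bot] at this
    · filter_upwards [hw b j, hw (b * c) (j + k)] with x h1 h2 X hX
      rw [tmul_lie_tmul_lie, h1 X hX, lie_zero, add_zero]
      apply h2
      have := hP.lie_mem _ _ X Y hX hY
      rwa [add_right_comm] at this
  have : v ∈ N := by rw [hN]; exact Submodule.mem_top
  exact this

lemma eventually_add_zsmul_ne {σ : Fin n → ℤ} (hσ : σ ≠ 0) (j k : Fin n → ℤ) :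
    ∀ᶠ x : ℤ in Filter.atTop, j + x • σ ≠ k := by
  by_cases h : ∃ x₀ : ℤ, j + x₀ • σ = k
  · obtain ⟨x₀, hx₀⟩ := h
    filter_upwards [Filter.eventually_gt_atTop x₀] with x hx heq
    rw [← hx₀, add_right_inj] at heq
    exact hx.ne' (smul_left_injective ℤ hσ heq)
  · push Not at h
    exact Filter.Eventually.of_forall h

lemma IsDegreeGrading.eventually_mem_killSet (hP : IsDegreeGrading P d γ) {σ : Fin n → ℤ}
    (hσ : σ ≠ 0) (h : ∀ v : V, EventuallyKills P B σ v) (s j : Fin n → ℤ)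
    [FiniteDimensional ℂ (wt B V d l s)] :
    ∀ᶠ x : ℤ in Filter.atTop, j + x • σ ∈ killSet B V P d l s := by
  obtain ⟨S, hS⟩ : (wt B V d l s).FG := Module.Finite.iff_fg.mp inferInstance
  have h1 : ∀ᶠ x : ℤ in Filter.atTop, ∀ v ∈ S, Kills P (1 : B) (j + x • σ) v :=
    (Filter.eventually_all_finset S).mpr fun v _ => h v 1 j
  filter_upwards [h1, eventually_add_zsmul_ne hσ j 0] with x hx hne
  refine hP.mem_killSet_of_one hne fun v hv X hX => ?_
  have : wt B V d l s ≤ LinearMap.ker (LieModule.toEnd ℂ (B ⊗[ℂ] τ) V (1 ⊗ₜ X)) := by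
    rw [← hS, Submodule.span_le]
    exact fun v hv => hx v hv X hX
  exact this hv

/-- Going up along `σ`, every string of weights eventually stops. -/
lemma IsDegreeGrading.eventually_wt_eq_bot (hP : IsDegreeGrading P d γ)
    (hfd : ∀ s, FiniteDimensional ℂ (wt B V d l s)) {σ : Fin n → ℤ}
    (hσ : σ ≠ 0) (h : ∀ v : V, EventuallyKills P B σ v) (s : Fin n → ℤ) :
    ∀ᶠ y : ℤ in Filter.atTop, wt B V d l (s + y • σ) = ⊥ := by
  obtain ⟨N, hN⟩ := Filter.eventually_atTop.mp (hP.eventually_mem_killSet hσ h (l := l) s 0)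
  simp only [zero_add] at hN
  have hzero : ∀ᶠ y : ℤ in Filter.atTop, ¬ ∀ i, l i + ((s + y • σ) i : ℂ) = 0 := by
    by_cases hex : ∃ y₀ : ℤ, ∀ i, l i + ((s + y₀ • σ) i : ℂ) = 0
    · obtain ⟨y₀, hy₀⟩ := hex
      filter_upwards [eventually_add_zsmul_ne hσ s (s + y₀ • σ)] with y hy hall
      apply hy
      ext i
      have := (hall i).trans (hy₀ i).symm
      exact_mod_cast add_left_cancel this
    · push Not at hex
      exact Filter.Eventually.of_forall fun y => not_forall.mpr (hex y)
  filter_upwards [hzero, Filter.eventually_ge_atTop N, Filter.eventually_gt_atTop (-N)]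
    with y hy0 hyN hypos
  obtain ⟨N', hN'⟩ := Filter.eventually_atTop.mp
    (hP.eventually_mem_killSet hσ h (l := l) (s + y • σ) 0)
  simp only [zero_add] at hN'
  have hdown : ∀ k : ℕ, ∀ x : ℤ, max N' N - k ≤ x → N - y ≤ x →
      x • σ ∈ killSet B V P d l (s + y • σ) := by
    intro k
    induction k with
    | zero =>
      intro x hx _
      exact hN' x (by have := le_max_left N' N; simp at hx; omega)
    | succ k ih =>
      intro x hx hxy
      by_cases hlt : max N' N - k ≤ x
      · exact ih x hlt hxy
      have hsub : s - (s + y • σ) = (-y) • σ := by rw [neg_smul]; abel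
      have h1 := ih (x + y) (by push_cast at hx; omega) (by omega)
      have h2 := hP.sub_mem_killSet (s := s) (s' := s + y • σ) (k := (x + y) • σ) (by
        rw [hsub]
        intro heq
        have := smul_left_injective ℤ hσ heq
        have hx' : x + y = -y := this
        omega) (hN _ (by omega)) h1
      rw [hsub, ← add_smul] at h2
      simpa using h2
  have h0 : (0 : Fin n → ℤ) ∈ killSet B V P d l (s + y • σ) := by
    have := hdown (max N' N).toNat 0 (by omega) (by omega)
    simpa using this
  rw [Submodule.eq_bot_iff]
  intro v hv
  obtain ⟨i, hi⟩ := not_forall.mp hy0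
  have h1 := h0 1 v hv (d i) (hP.d_mem i)
  rw [mem_wt.mp hv i, smul_eq_zero] at h1
  exact h1.resolve_left hi

end Module

section GeneralizedHighestWeight

variable {B : Type} [CommRing B] [Algebra ℂ B]
variable {V : Type} [AddCommGroup V] [Module ℂ V] [LieRingModule (B ⊗[ℂ] τ) V]
  [LieModule ℂ (B ⊗[ℂ] τ) V]
variable {P : (Fin n → ℤ) → Submodule ℂ τ} {d : Fin n → τ} {γ : ℕ} {l : Fin n → ℂ}

/-- The zero vector and the standard basis vectors of `ℤⁿ`. -/
def zeroOrUnit : Option (Fin n) → Fin n → ℤ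
  | none => 0
  | some i => Pi.single i 1

lemma IsDegreeGrading.exists_forall_kills (hP : IsDegreeGrading P d γ)
    (hfd : ∀ s, FiniteDimensional ℂ (wt B V d l s)) (S : Finset B) {s t : Fin n → ℤ}
    (h : S.card * γ * ∑ i, Module.finrank ℂ (wt B V d l (s + zeroOrUnit i)) <
      Module.finrank ℂ (wt B V d l t)) :
    ∃ v : V, v ≠ 0 ∧ ∀ c ∈ S, ∀ i, Kills P c (s - t + zeroOrUnit i) v := by
  choose g hg using hP.exists_gens
  have hgm : ∀ i a, g (s - t + zeroOrUnit i) a ∈ P (s - t + zeroOrUnit i) := fun i a => by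
    rw [← hg]
    exact Submodule.subset_span ⟨a, rfl⟩
  let f : (q : S × Fin γ) → (i : Option (Fin n)) →
      wt B V d l t →ₗ[ℂ] wt B V d l (s + zeroOrUnit i) := fun q i =>
    ((LieModule.toEnd ℂ (B ⊗[ℂ] τ) V (q.1.1 ⊗ₜ g (s - t + zeroOrUnit i) q.2)).restrict
      (p := wt B V d l t) (q := wt B V d l (s + zeroOrUnit i)) (fun v hv => by
        have := hP.lie_mem_wt (hgm i q.2) q.1.1 hv
        rwa [← add_assoc, add_sub_cancel] at this))
  let F := LinearMap.pi fun q => LinearMap.pi (f q)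
  have hker : LinearMap.ker F ≠ ⊥ := by
    apply LinearMap.ker_ne_bot_of_finrank_lt
    simpa [Module.finrank_pi_fintype] using h
  obtain ⟨v, hv, hv0⟩ := Submodule.exists_mem_ne_zero_of_ne_bot hker
  refine ⟨v, by simpa using hv0, fun c hc i X hX => ?_⟩
  have key : P (s - t + zeroOrUnit i) ≤ LinearMap.ker (actRight c (v : V)) := by
    rw [← hg, Submodule.span_le]
    rintro _ ⟨a, rfl⟩
    have h0 : F v = 0 := hv
    let q : S × Fin γ := (⟨c, hc⟩, a)
    have h1 : F v q i = 0 := by rw [h0]; rfl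
    exact congrArg Subtype.val h1
  exact key hX

lemma eventually_mem_closure_zeroOrUnit (g z : Fin n → ℤ) :
    ∀ᶠ x : ℤ in Filter.atTop, z + x • (((n : ℤ) + 1) • g + 1) ∈
      AddSubmonoid.closure (Set.range fun i : Option (Fin n) => g + zeroOrUnit i) := by
  have h1 : ∀ᶠ x : ℤ in Filter.atTop, ∀ i, 0 ≤ x + z i :=
    Filter.eventually_all.mpr fun i => by
      filter_upwards [Filter.eventually_ge_atTop (-z i)] with x hx
      omega
  filter_upwards [h1, Filter.eventually_ge_atTop (∑ i, z i)] with x hx hx'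
  have hmem : ∀ (i : Option (Fin n)) (y : ℤ), 0 ≤ y → y • (g + zeroOrUnit i) ∈
      AddSubmonoid.closure (Set.range fun i : Option (Fin n) => g + zeroOrUnit i) := by
    intro i y hy
    lift y to ℕ using hy
    rw [natCast_zsmul]
    exact AddSubmonoid.nsmul_mem _ (AddSubmonoid.subset_closure (Set.mem_range_self i)) _
  have hsum : z + x • (((n : ℤ) + 1) • g + 1) = (x - ∑ i, z i) • (g + zeroOrUnit none) +
      ∑ i, (x + z i) • (g + zeroOrUnit (some i)) := by
    ext p
    simp only [zeroOrUnit, Pi.add_apply, Pi.smul_apply, Finset.sum_apply, smul_eq_mul,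
      Pi.one_apply, Pi.zero_apply, mul_add, Finset.sum_add_distrib, Pi.single_apply, mul_ite,
      mul_one, mul_zero, Finset.sum_ite_eq, Finset.mem_univ, if_true, ← Finset.sum_mul]
    simp
    ring
  rw [hsum]
  exact add_mem (hmem _ _ (by omega)) (sum_mem fun i _ => hmem _ _ (hx i))

lemma IsDegreeGrading.eventuallyKills_of_kills (hn : 0 < n) (hP : IsDegreeGrading P d γ)
    {S : Finset B} (hS1 : 1 ∈ S) (hS : Algebra.adjoin ℂ (S : Set B) = ⊤) {g : Fin n → ℤ}
    {p : Fin n} (hg : 3 ≤ |g p|) {v : V}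
    (hv : ∀ c ∈ S, ∀ i, Kills P c (g + zeroOrUnit i) v) :
    EventuallyKills P B (((n : ℤ) + 1) • g + 1) v := by
  set σ := ((n : ℤ) + 1) • g + 1 with hσdef
  have hσ : σ ≠ 0 := by
    intro h0
    have := congrFun h0 p
    simp only [hσdef, Pi.add_apply, Pi.smul_apply, smul_eq_mul, Pi.one_apply, Pi.zero_apply] at this
    rcases le_abs.mp hg with h | h <;> nlinarith
  have hk : ∀ i, (zeroOrUnit i : Fin n → ℤ) p = 0 ∨ (zeroOrUnit i : Fin n → ℤ) p = 1 := by
    rintro (_ | i)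
    · exact Or.inl rfl
    · simp only [zeroOrUnit, Pi.single_apply]
      split_ifs <;> simp
  have hkp : (zeroOrUnit (some p) : Fin n → ℤ) p = 1 := by simp [zeroOrUnit]
  have hk0 : (zeroOrUnit none : Fin n → ℤ) p = 0 := rfl
  have hbase : ∀ c ∈ AddSubmonoid.closure
      (Set.range fun i : Option (Fin n) => g + zeroOrUnit i),
      Kills P (1 : B) (g + zeroOrUnit (some p) + (g + zeroOrUnit none) + c) v ∧
      (3 ≤ g p ∧ 0 ≤ c p ∨ g p ≤ -3 ∧ c p ≤ 0) := by
    intro c hc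
    induction hc using AddSubmonoid.closure_induction_right with
    | zero =>
      refine ⟨?_, ?_⟩
      · have := hP.kills_add (m := g + zeroOrUnit (some p)) (k := g + zeroOrUnit none)
          (fun h => by simpa [zeroOrUnit] using congrFun h p)
          (hv 1 hS1 (some p)) (hv 1 hS1 none)
        simpa using this
      · rcases le_abs.mp hg with h | h
        · exact Or.inl ⟨h, le_rfl⟩
        · exact Or.inr ⟨by omega, le_rfl⟩
    | add_right c y hc hy ih =>
      obtain ⟨i, rfl⟩ := hy
      have hi := hk i
      refine ⟨?_, ?_⟩
      · have := hP.kills_add (k := g + zeroOrUnit i) (fun h => by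
          have := congrFun h p
          simp only [Pi.add_apply, hkp, hk0] at this
          omega) ih.1 (hv 1 hS1 i)
        rwa [one_mul, add_assoc] at this
      · simp only [Pi.add_apply]
        omega
  have hone : ∀ j, ∀ᶠ x : ℤ in Filter.atTop, Kills P (1 : B) (j + x • σ) v := by
    intro j
    filter_upwards [eventually_mem_closure_zeroOrUnit g
      (j - (g + zeroOrUnit (some p) + (g + zeroOrUnit none)))] with x hx
    have := (hbase _ hx).1
    convert this using 1
    rw [← hσdef]
    abel
  intro b
  have hmul : ∀ a : B, (∀ j, ∀ᶠ x : ℤ in Filter.atTop, Kills P a (j + x • σ) v) →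
      ∀ j, ∀ᶠ x : ℤ in Filter.atTop, Kills P (a * b) (j + x • σ) v := by
    have hb : b ∈ Algebra.adjoin ℂ (S : Set B) := by rw [hS]; trivial
    induction hb using Algebra.adjoin_induction with
    | mem c hc =>
      intro a ha j
      filter_upwards [ha (j - (g + zeroOrUnit none)), eventually_add_zsmul_ne hσ
        (j - (g + zeroOrUnit none)) (g + zeroOrUnit none)] with x h1 h2
      have := hP.kills_add h2 h1 (hv c hc none)
      convert this using 1
      abel
    | algebraMap r =>
      intro a ha j
      filter_upwards [ha j] with x h1 X hX
      have := (actLeft X v).map_smul r a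
      rw [actLeft_apply, actLeft_apply, h1 X hX, smul_zero] at this
      rwa [mul_comm, ← Algebra.smul_def]
    | add c c' _ _ h1 h2 =>
      intro a ha j
      filter_upwards [h1 a ha j, h2 a ha j] with x h1 h2 X hX
      rw [mul_add, TensorProduct.add_tmul, add_lie, h1 X hX, h2 X hX, add_zero]
    | mul c c' _ _ h1 h2 =>
      intro a ha
      rw [← mul_assoc]
      exact h2 _ (h1 a ha)
  simpa using hmul 1 hone

/-- A weight space that is large compared with the weight spaces around `s` contains a
generalized highest weight vector. -/
lemma IsDegreeGrading.exists_eventuallyKills (hn : 0 < n) (hP : IsDegreeGrading P d γ)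
    (hfd : ∀ s, FiniteDimensional ℂ (wt B V d l s)) (hB : Algebra.FiniteType ℂ B)
    (hirr : LieModule.IsIrreducible ℂ (B ⊗[ℂ] τ) V) (s : Fin n → ℤ) :
    ∃ N : ℕ, ∀ t, (∃ p, 3 ≤ |(s - t) p|) → N < Module.finrank ℂ (wt B V d l t) →
      ∀ v : V, EventuallyKills P B (((n : ℤ) + 1) • (s - t) + 1) v := by
  classical
  obtain ⟨S, hS⟩ := hB.out
  refine ⟨(insert 1 S).card * γ * ∑ i, Module.finrank ℂ (wt B V d l (s + zeroOrUnit i)),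
    fun t ⟨p, hp⟩ ht => ?_⟩
  obtain ⟨v, hv0, hv⟩ := hP.exists_forall_kills hfd _ ht
  refine hP.eventuallyKills_of_exists hirr hv0
    (hP.eventuallyKills_of_kills hn (Finset.mem_insert_self _ _) ?_ hp hv)
  rw [eq_top_iff, ← hS]
  exact Algebra.adjoin_mono (by simp)

end GeneralizedHighestWeight

lemma eventually_mul_ne {a : ℤ} (ha : a ≠ 0) (c : ℤ) :
    ∀ᶠ i : ℤ in Filter.atTop, i * a ≠ c := by
  filter_upwards [Filter.eventually_gt_atTop |c|] with i hi h
  have h1 : |i| * |a| = |c| := by rw [← abs_mul, h]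
  have h2 : 1 ≤ |a| := Int.one_le_abs ha
  have h3 := le_abs_self i
  nlinarith [abs_nonneg c]

/-- A set of lattice points closed under sums of distinct elements and containing a half line of
every line parallel to `σ` is everything as soon as it generates a negative multiple of `σ`. -/
lemma eq_univ_of_neg_mem_closure (hn : 2 ≤ n) {Q : Set (Fin n → ℤ)} {σ : Fin n → ℤ} (hσ : σ ≠ 0)
    (hadd : ∀ m ∈ Q, ∀ k ∈ Q, m ≠ k → m + k ∈ Q)
    (hlarge : ∀ j, ∀ᶠ x : ℤ in Filter.atTop, j + x • σ ∈ Q) {x : ℕ} (hx : 0 < x)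
    (hmem : -((x : ℤ) • σ) ∈ AddSubmonoid.closure Q) : Q = Set.univ := by
  classical
  have hG : ∀ g ∈ AddSubmonoid.closure Q, ∃ F : Finset (Fin n → ℤ),
      ∀ m ∈ Q, m ∉ F → m + g ∈ Q := by
    intro g hg
    induction hg using AddSubmonoid.closure_induction with
    | mem g hg =>
      exact ⟨{g}, fun m hm hF => hadd m hm g hg (by simpa using hF)⟩
    | zero => exact ⟨∅, fun m hm _ => by simpa using hm⟩
    | add g g' _ _ h h' =>
      obtain ⟨F, hF⟩ := h
      obtain ⟨F', hF'⟩ := h'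
      refine ⟨F ∪ F'.image (fun m => m - g), fun m hm hmF => ?_⟩
      rw [Finset.mem_union, not_or] at hmF
      rw [← add_assoc]
      refine hF' _ (hF m hm hmF.1) fun hmem => hmF.2 ?_
      exact Finset.mem_image.mpr ⟨_, hmem, by abel⟩
  obtain ⟨F, hF⟩ := hG _ hmem
  have hline : ∀ j, (∀ y : ℤ, j + y • σ ∉ F) → j ∈ Q := by
    intro j hj
    obtain ⟨N, hN⟩ := Filter.eventually_atTop.mp (hlarge j)
    have hfin : ∀ i : ℕ, i ≤ N.toNat → j + ((N.toNat - i : ℤ) * x) • σ ∈ Q := by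
      intro i
      induction i with
      | zero =>
        intro _
        apply hN
        have h1 : N ≤ N.toNat := Int.self_le_toNat N
        have h2 : (1 : ℤ) ≤ x := by exact_mod_cast hx
        have h3 : (0 : ℤ) ≤ N.toNat := by positivity
        push_cast
        nlinarith
      | succ i ih =>
        intro hi
        have := hF _ (ih (by omega)) (hj _)
        convert this using 1
        rw [add_assoc, ← neg_smul, ← add_smul]
        push_cast
        ring_nf
    simpa using hfin N.toNat le_rfl
  obtain ⟨p, hp⟩ := Function.ne_iff.mp hσ
  have : Nontrivial (Fin n) := Fin.nontrivial_iff_two_le.mpr hn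
  obtain ⟨q, hq⟩ := exists_ne p
  let f : (Fin n → ℤ) → ℤ := fun z => σ p * z q - σ q * z p
  have hline' : ∀ j, (∀ m ∈ F, f j ≠ f m) → j ∈ Q := by
    refine fun j hj => hline j fun y hy => hj _ hy ?_
    simp only [f, Pi.add_apply, Pi.smul_apply, smul_eq_mul]
    ring
  rw [Set.eq_univ_iff_forall]
  intro j
  have h1 : ∀ᶠ i : ℤ in Filter.atTop, ∀ m ∈ F, i * σ p ≠ f m ∧ i * σ p ≠ f j - f m :=
    (Filter.eventually_all_finset F).mpr fun m _ =>
      (eventually_mul_ne hp _).and (eventually_mul_ne hp _)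
  have h2 := eventually_mul_ne (mul_ne_zero two_ne_zero hp) (f j)
  obtain ⟨i, hi1, hi2⟩ := (h1.and h2).exists
  have hfi : f (Pi.single q i) = i * σ p := by
    simp only [f, Pi.single_eq_same, Pi.single_eq_of_ne hq.symm]
    ring
  have hfj : f (j - Pi.single q i) = f j - f (Pi.single q i) := by
    simp only [f, Pi.sub_apply]
    ring
  have := hadd (Pi.single q i) (hline' _ fun m hm => by rw [hfi]; exact (hi1 m hm).1)
    (j - Pi.single q i) (hline' _ fun m hm h => (hi1 m hm).2 (by rw [← h, hfj, hfi]; ring))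
    (fun h => hi2 (by have := congrArg f h; rw [hfj, hfi] at this; linarith))
  simpa using this

section Strings

variable {B : Type} [CommRing B] [Algebra ℂ B]
variable {V : Type} [AddCommGroup V] [Module ℂ V] [LieRingModule (B ⊗[ℂ] τ) V]
  [LieModule ℂ (B ⊗[ℂ] τ) V]
variable {P : (Fin n → ℤ) → Submodule ℂ τ} {d : Fin n → τ} {γ : ℕ} {l : Fin n → ℂ}

lemma IsDegreeGrading.neg_notMem_closure_killSet (hn : 2 ≤ n) (hP : IsDegreeGrading P d γ)
    (hirr : LieModule.IsIrreducible ℂ (B ⊗[ℂ] τ) V)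
    (hfd : ∀ s, FiniteDimensional ℂ (wt B V d l s))
    (hunb : ∀ N : ℕ, ∃ t, N < Module.finrank ℂ (wt B V d l t)) {σ : Fin n → ℤ}
    (hσ : σ ≠ 0) (h : ∀ v : V, EventuallyKills P B σ v) {s : Fin n → ℤ} (hs : wt B V d l s ≠ ⊥)
    {x : ℕ} (hx : 0 < x) : -((x : ℤ) • σ) ∉ AddSubmonoid.closure (killSet B V P d l s) := by
  intro hmem
  have huniv := eq_univ_of_neg_mem_closure hn hσ
    (fun m hm k hk hmk => hP.add_mem_killSet hmk hm hk)
    (fun j => hP.eventually_mem_killSet hσ h s j) hx hmem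
  have htop : wt B V d l s = ⊤ := hP.eq_top_of_stable hirr _ hs fun b k X hX v hv => by
    have hk : k ∈ killSet B V P d l s := by rw [huniv]; trivial
    rw [hk b v hv X hX]
    exact Submodule.zero_mem _
  have hV : FiniteDimensional ℂ V := by
    have := hfd s
    rw [htop] at this
    exact Module.Finite.equiv (Submodule.topEquiv (R := ℂ) (M := V))
  obtain ⟨t, ht⟩ := hunb (Module.finrank ℂ V)
  exact absurd (Submodule.finrank_le (wt B V d l t)) (by omega)

/-- Going down along `σ` one never leaves the set of weights. -/
lemma IsDegreeGrading.wt_sub_ne_bot (hn : 2 ≤ n) (hP : IsDegreeGrading P d γ)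
    (hirr : LieModule.IsIrreducible ℂ (B ⊗[ℂ] τ) V)
    (hfd : ∀ s, FiniteDimensional ℂ (wt B V d l s))
    (hunb : ∀ N : ℕ, ∃ t, N < Module.finrank ℂ (wt B V d l t)) {σ : Fin n → ℤ}
    (hσ : σ ≠ 0) (h : ∀ v : V, EventuallyKills P B σ v) {s : Fin n → ℤ}
    (hs : wt B V d l s ≠ ⊥) : wt B V d l (s - σ) ≠ ⊥ := by
  intro h0
  refine hP.neg_notMem_closure_killSet hn hirr hfd hunb hσ h hs one_pos
    (AddSubmonoid.subset_closure ?_)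
  apply hP.mem_killSet_of_wt_eq_bot
  simpa [← sub_eq_add_neg] using h0

lemma IsDegreeGrading.wt_add_sub_ne_bot_or (hn : 2 ≤ n) (hP : IsDegreeGrading P d γ)
    (hirr : LieModule.IsIrreducible ℂ (B ⊗[ℂ] τ) V)
    (hfd : ∀ s, FiniteDimensional ℂ (wt B V d l s))
    (hunb : ∀ N : ℕ, ∃ t, N < Module.finrank ℂ (wt B V d l t)) {σ : Fin n → ℤ}
    (hσ : σ ≠ 0) (h : ∀ v : V, EventuallyKills P B σ v) {s : Fin n → ℤ}
    (hs : wt B V d l s ≠ ⊥) (e : Fin n → ℤ) :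
    wt B V d l (s + (e - σ)) ≠ ⊥ ∨ wt B V d l (s + (-e - σ)) ≠ ⊥ := by
  by_contra! h0
  refine hP.neg_notMem_closure_killSet hn hirr hfd hunb hσ h hs two_pos ?_
  have := add_mem (AddSubmonoid.subset_closure (hP.mem_killSet_of_wt_eq_bot h0.1))
    (AddSubmonoid.subset_closure (hP.mem_killSet_of_wt_eq_bot h0.2))
  convert this using 1
  push_cast
  rw [two_smul]
  abel

end Strings

/-- The embedding `ℤⁿ → ℝⁿ`. -/
def realVec (n : ℕ) : (Fin n → ℤ) →+ (Fin n → ℝ) := (Int.castAddHom ℝ).compLeft (Fin n)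

@[simp] lemma realVec_apply (z : Fin n → ℤ) (i : Fin n) : realVec n z i = z i := rfl

/-- Multiples of a point of the real cone generated by `Q` are at bounded distance from the
monoid generated by `Q`. -/
lemma exists_bound_of_mem_hull {Q : Set (Fin n → ℤ)} {v : Fin n → ℝ}
    (hv : v ∈ PointedCone.hull ℝ (realVec n '' Q)) :
    ∃ R : ℝ, ∀ N : ℕ, ∃ z ∈ AddSubmonoid.closure Q, ∀ i, |(z i : ℝ) - N * v i| ≤ R := by
  induction hv using Submodule.span_induction with
  | mem v hv =>
    obtain ⟨k, hk, rfl⟩ := hv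
    refine ⟨0, fun N => ⟨N • k, AddSubmonoid.nsmul_mem _ (AddSubmonoid.subset_closure hk) _,
      fun i => ?_⟩⟩
    simp
  | zero => exact ⟨0, fun N => ⟨0, zero_mem _, fun i => by simp⟩⟩
  | add v w _ _ hv hw =>
    obtain ⟨R, hR⟩ := hv
    obtain ⟨R', hR'⟩ := hw
    refine ⟨R + R', fun N => ?_⟩
    obtain ⟨z, hz, hzi⟩ := hR N
    obtain ⟨z', hz', hzi'⟩ := hR' N
    refine ⟨z + z', add_mem hz hz', fun i => ?_⟩
    have : (((z + z') i : ℤ) : ℝ) - N * (v + w) i = (z i - N * v i) + (z' i - N * w i) := by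
      simp only [Pi.add_apply]
      push_cast
      ring
    rw [this]
    exact (abs_add_le _ _).trans (add_le_add (hzi i) (hzi' i))
  | smul a v _ hv =>
    obtain ⟨R, hR⟩ := hv
    refine ⟨R + ∑ i, |v i|, fun N => ?_⟩
    obtain ⟨z, hz, hzi⟩ := hR ⌈(N : ℝ) * a⌉₊
    refine ⟨z, hz, fun i => ?_⟩
    have ha : 0 ≤ (N : ℝ) * a := mul_nonneg N.cast_nonneg a.2
    have : (z i : ℝ) - N * (a • v) i =
        (z i - ⌈(N : ℝ) * a⌉₊ * v i) + (⌈(N : ℝ) * a⌉₊ - N * a) * v i := by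
      change (z i : ℝ) - N * ((a : ℝ) * v i) = _
      ring
    rw [this]
    refine (abs_add_le _ _).trans (add_le_add (hzi i) ?_)
    rw [abs_mul]
    have h1 : |(⌈(N : ℝ) * a⌉₊ : ℝ) - N * a| ≤ 1 := by
      rw [abs_le]
      constructor <;> linarith [Nat.le_ceil ((N : ℝ) * a), Nat.ceil_lt_add_one ha]
    have h2 : |v i| ≤ ∑ i, |v i| :=
      Finset.single_le_sum (f := fun i => |v i|) (fun i _ => abs_nonneg _) (Finset.mem_univ i)
    nlinarith [abs_nonneg (v i)]

/-- A supporting functional of `Q`, normalised at `σ`. -/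
lemma exists_addMonoidHom_nonneg {Q : Set (Fin n → ℤ)} {σ : Fin n → ℤ} (hσ : σ ≠ 0)
    (hneg : ∀ x : ℕ, 0 < x → -((x : ℤ) • σ) ∉ AddSubmonoid.closure Q)
    (hlarge : ∀ j, ∀ᶠ x : ℤ in Filter.atTop, j + x • σ ∈ Q) :
    ∃ h : (Fin n → ℤ) →+ ℝ, h σ = 1 ∧ ∀ k ∈ Q, 0 ≤ h k := by
  set s := PointedCone.hull ℝ (realVec n '' Q)
  have hσ' : realVec n σ ≠ 0 := fun h => hσ (by
    ext i
    exact Int.cast_injective (α := ℝ) (by simpa using congrFun h i))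
  have hQs : ∀ k ∈ Q, realVec n k ∈ s := fun k hk => Submodule.subset_span ⟨k, hk, rfl⟩
  have hsmul : ∀ a : ℝ, 0 ≤ a → ∀ v ∈ s, a • v ∈ s := fun a ha v hv =>
    s.smul_mem ha hv
  have hz : ∀ (x : ℤ), realVec n (x • σ) = (x : ℝ) • realVec n σ := fun x => by
    ext i
    simp
  obtain ⟨g, hg, hgs⟩ := riesz_extension s (LinearPMap.mkSpanSingleton (realVec n σ) (1 : ℝ) hσ')
    (by
      rintro ⟨v, hv⟩ hvs
      obtain ⟨c, rfl⟩ := Submodule.mem_span_singleton.mp hv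
      rw [LinearPMap.mkSpanSingleton'_apply]
      simp only [RingHom.id_apply, smul_eq_mul, mul_one]
      by_contra! hc
      obtain ⟨R, hR⟩ := exists_bound_of_mem_hull hvs
      let R' : ℤ := ⌈R + ∑ i, |(σ i : ℝ)|⌉
      have hbox : ∀ᶠ x : ℤ in Filter.atTop, ∀ w ∈ Finset.Icc (fun _ : Fin n => -R') (fun _ => R'),
          -w + x • σ ∈ Q := (Filter.eventually_all_finset _).mpr fun w _ => hlarge _
      obtain ⟨M, hM⟩ := hbox.exists
      obtain ⟨N, hN⟩ := exists_nat_gt ((M + 1) / (-c))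
      obtain ⟨z, hzQ, hzi⟩ := hR N
      have hMN : (M : ℝ) + 1 < N * (-c) := by
        rwa [div_lt_iff₀ (by linarith)] at hN
      let x : ℤ := ⌊(N : ℝ) * (-c)⌋
      have hx1 : M < x := by
        have : M + 1 ≤ x := Int.le_floor.mpr (by push_cast; linarith)
        omega
      have hw : z + x • σ ∈ Finset.Icc (fun _ : Fin n => -R') (fun _ => R') := by
        have hb : ∀ i, |((z + x • σ) i : ℝ)| ≤ R' := fun i => by
          have : (((z + x • σ) i : ℤ) : ℝ) =
              (z i - N * (c • realVec n σ) i) + (x - N * (-c)) * σ i := by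
            simp only [Pi.add_apply, Pi.smul_apply, smul_eq_mul, realVec_apply]
            push_cast
            ring
          rw [this]
          refine ((abs_add_le _ _).trans (add_le_add (hzi i) ?_)).trans
            (Int.le_ceil (R + ∑ i, |(σ i : ℝ)|))
          rw [abs_mul]
          have h1 : |(x : ℝ) - N * (-c)| ≤ 1 := by
            rw [abs_le]
            constructor <;>
              linarith [Int.floor_le ((N : ℝ) * (-c)), Int.sub_one_lt_floor ((N : ℝ) * (-c))]
          have h2 : |(σ i : ℝ)| ≤ ∑ i, |(σ i : ℝ)| :=
            Finset.single_le_sum (f := fun i => |(σ i : ℝ)|) (fun i _ => abs_nonneg _)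
              (Finset.mem_univ i)
          nlinarith [abs_nonneg (σ i : ℝ)]
        rw [Finset.mem_Icc]
        constructor <;> intro i
        · have := (abs_le.mp (hb i)).1
          exact_mod_cast this
        · have := (abs_le.mp (hb i)).2
          exact_mod_cast this
      refine hneg (x - M).toNat (by omega) ?_
      have := add_mem hzQ (AddSubmonoid.subset_closure (hM _ hw))
      convert this using 1
      rw [Int.toNat_of_nonneg (by omega), sub_smul]
      abel)
    (by
      have hone : ∀ (y : Fin n → ℝ) i, ∃ a : ℝ,
          a • realVec n σ + Pi.single i (y i) ∈ s := by
        intro y i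
        obtain ⟨M, h1, h2⟩ := ((hlarge (Pi.single i 1)).and (hlarge (-Pi.single i 1))).exists
        rcases le_total 0 (y i) with hy | hy
        · refine ⟨y i * M, ?_⟩
          convert hsmul _ hy _ (hQs _ h1) using 1
          rw [map_add, hz, smul_add, smul_smul, add_comm]
          congr 1
          ext j
          by_cases hj : j = i <;> simp [hj]
        · refine ⟨-y i * M, ?_⟩
          convert hsmul _ (neg_nonneg.mpr hy) _ (hQs _ h2) using 1
          rw [map_add, hz, smul_add, smul_smul, add_comm]
          congr 1
          ext j
          by_cases hj : j = i <;> simp [hj]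
      intro y
      choose a ha using hone y
      refine ⟨⟨(∑ i, a i) • realVec n σ, Submodule.smul_mem _ _
        (Submodule.mem_span_singleton_self _)⟩, ?_⟩
      have := Submodule.sum_mem s (t := Finset.univ) fun i _ => ha i
      rwa [Finset.sum_add_distrib, ← Finset.sum_smul, Finset.univ_sum_single] at this)
  refine ⟨g.toAddMonoidHom.comp (realVec n), ?_, fun k hk => hgs _ (hQs k hk)⟩
  have := hg ⟨realVec n σ, Submodule.mem_span_singleton_self _⟩
  rw [LinearPMap.mkSpanSingleton_apply] at this
  exact this

section Growth

variable {B : Type} [CommRing B] [Algebra ℂ B]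
variable {V : Type} [AddCommGroup V] [Module ℂ V] [LieRingModule (B ⊗[ℂ] τ) V]
  [LieModule ℂ (B ⊗[ℂ] τ) V]
variable {P : (Fin n → ℤ) → Submodule ℂ τ} {d : Fin n → τ} {γ : ℕ} {l : Fin n → ℂ}

/-- If a string of weights in direction `q` stops at `t` and the weight `l + t` is not
proportional to `q`, then the dimensions of the weight spaces grow when going back. -/
lemma IsDegreeGrading.le_finrank_wt (hP : IsDegreeGrading P d γ)
    (hfd : ∀ s, FiniteDimensional ℂ (wt B V d l s)) {q : Fin n → ℤ} (hq : q ≠ 0)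
    {w : Fin n → ℂ} (hwq : ∑ i, w i * (q i : ℂ) = 0) {t : Fin n → ℤ} (ht : wt B V d l t ≠ ⊥)
    (hlast : ∀ x : ℤ, 0 < x → wt B V d l (t + x • q) = ⊥)
    (hw : ∑ i, w i * (l i + (t i : ℂ)) ≠ 0) (K : ℕ) :
    K ≤ Module.finrank ℂ (wt B V d l (t - (2 * K + 2 : ℤ) • q)) := by
  obtain ⟨L, J, hL, hJ, hLJ, hJJ, hJ0⟩ := hP.exists_line q hq w hwq
  obtain ⟨z, hz, hz0⟩ := Submodule.exists_mem_ne_zero_of_ne_bot ht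
  set μ := ∑ i, w i * (l i + (t i : ℂ))
  let A : τ → V →ₗ[ℂ] V := fun X => LieModule.toEnd ℂ (B ⊗[ℂ] τ) V ((1 : B) ⊗ₜ X)
  have hAA : ∀ X Y v, A X (A Y v) = A ⁅X, Y⁆ v + A Y (A X v) := fun X Y v => by
    have := tmul_lie_tmul_lie (1 : B) 1 X Y v
    rwa [one_mul] at this
  have hAs : ∀ (c : ℂ) X v, A (c • X) v = c • A X v := fun c X v => smul_tmul_lie c 1 X v
  have hJc : ∀ x y v, A (J x) (A (J y) v) = A (J y) (A (J x) v) := fun x y v => by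
    rw [hAA, hJJ, ← zero_smul ℂ (0 : τ), hAs, zero_smul, zero_add]
  have hLc : ∀ x y v, A (L x) (A (J y) v) = (y : ℂ) • A (J (x + y)) v + A (J y) (A (L x) v) :=
    fun x y v => by rw [hAA, hLJ, hAs]
  have hwt : ∀ {s k : Fin n → ℤ} {X : τ} {v : V}, X ∈ P k → v ∈ wt B V d l s →
      A X v ∈ wt B V d l (s + k) := fun hX hv => hP.lie_mem_wt hX 1 hv
  have hpos : ∀ x : ℤ, 0 < x → ∀ X ∈ P (x • q), A X z = 0 := fun x hx X hX => by
    have := hwt hX hz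
    rwa [hlast x hx, Submodule.mem_bot] at this
  have hJ0z : A (J 0) z = μ • z := by
    have h1 : ∀ X, A X z = actRight (1 : B) z X := fun _ => rfl
    rw [hJ0, h1, map_sum, Finset.sum_smul]
    refine Finset.sum_congr rfl fun i _ => ?_
    rw [map_smul, actRight_apply, mem_wt.mp hz i, smul_smul]
  have hLb : ∀ b : ℤ, 0 < b → A (L b) (A (J (-b)) z) = (-(b * μ) : ℂ) • z := fun b hb => by
    rw [hLc, hpos b hb _ (hL b), map_zero, add_zero, add_neg_cancel, hJ0z, smul_smul]
    push_cast
    ring_nf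
  let f : Fin K → V := fun i => A (J (-(i + 1 : ℤ))) (A (J (-(2 * K + 2 - (i + 1) : ℤ))) z)
  have hf : ∀ i, f i ∈ wt B V d l (t - (2 * K + 2 : ℤ) • q) := fun i => by
    have := hwt (hJ (-(i + 1 : ℤ))) (hwt (hJ (-(2 * K + 2 - (i + 1) : ℤ))) hz)
    convert this using 2
    rw [add_assoc, ← add_smul, sub_eq_add_neg, ← neg_smul]
    congr 2
    ring
  have hLf : ∀ b a : Fin K, b ≤ a → A (L (2 * K + 2 - (b + 1))) (f a) =
      if b = a then (-(2 * K + 2 - (b + 1)) * μ : ℂ) • A (J (-(b + 1 : ℤ))) z else 0 := by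
    intro b a hba
    have hba' : (b : ℕ) ≤ a := hba
    have hz1 : A (J (2 * K + 2 - (b + 1) + -(a + 1 : ℤ))) z = 0 :=
      hpos _ (by omega) _ (hJ _)
    have hz2 : A (L (2 * K + 2 - (b + 1))) z = 0 := hpos _ (by omega) _ (hL _)
    simp only [f]
    rw [hLc, hLc, hJc, hz1, hz2]
    simp only [map_zero, smul_zero, zero_add, add_zero, map_smul]
    split_ifs with h
    · subst h
      rw [add_neg_cancel, hJ0z, map_smul, smul_smul]
      push_cast
      ring_nf
    · have hlt : (b : ℕ) < a := lt_of_le_of_ne hba' (fun h' => h (Fin.ext h'))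
      rw [hpos _ (by omega) _ (hJ _), map_zero, smul_zero]
  have hind : LinearIndependent ℂ f := by
    rw [Fintype.linearIndependent_iff]
    intro g hg i
    induction i using WellFoundedLT.induction with
    | ind i ih =>
      have h1 := congrArg (fun v => A (L (i + 1)) (A (L (2 * K + 2 - (i + 1))) v)) hg
      simp only [map_sum, map_smul, map_zero] at h1
      rw [Finset.sum_eq_single i] at h1
      · rw [hLf i i le_rfl, if_pos rfl, map_smul] at h1
        rw [hLb (i + 1) (by omega), smul_smul, smul_smul, smul_eq_zero] at h1
        have h3 := h1.resolve_right hz0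
        rw [mul_assoc] at h3
        have h4 : (2 * K + 2 - (i + 1) : ℂ) ≠ 0 := by
          have : (2 * K + 2 - (i + 1) : ℤ) ≠ 0 := by omega
          exact_mod_cast this
        have h5 : ((i + 1 : ℤ) : ℂ) ≠ 0 := by
          have : (i + 1 : ℤ) ≠ 0 := by omega
          exact_mod_cast this
        have h6 : (-(2 * K + 2 - (i + 1)) * μ * -((i + 1 : ℤ) * μ) : ℂ) ≠ 0 :=
          mul_ne_zero (mul_ne_zero (neg_ne_zero.mpr h4) hw) (neg_ne_zero.mpr (mul_ne_zero h5 hw))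
        exact (mul_eq_zero.mp h3).resolve_right h6
      · intro j _ hji
        rcases lt_or_gt_of_ne hji with hlt | hgt
        · rw [ih j hlt, zero_smul]
        · rw [hLf i j hgt.le, if_neg hgt.ne, map_zero, smul_zero]
      · exact fun h => absurd (Finset.mem_univ i) h
  have hind' : LinearIndependent ℂ (fun i => (⟨f i, hf i⟩ : wt B V d l _)) :=
    LinearIndependent.of_comp (Submodule.subtype _) hind
  simpa using hind'.fintype_card_le_finrank

end Growth

section HighestWeight

variable {B : Type} [CommRing B] [Algebra ℂ B]
variable {V : Type} [AddCommGroup V] [Module ℂ V] [LieRingModule (B ⊗[ℂ] τ) V]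
  [LieModule ℂ (B ⊗[ℂ] τ) V]
variable {P : (Fin n → ℤ) → Submodule ℂ τ} {d : Fin n → τ} {γ : ℕ} {l : Fin n → ℂ}

/-- Outside of a cube around `s`, all weight spaces of large dimension provide a direction in which
every vector is eventually annihilated. -/
lemma IsDegreeGrading.exists_bound_eventuallyKills (hn : 0 < n) (hP : IsDegreeGrading P d γ)
    (hfd : ∀ s, FiniteDimensional ℂ (wt B V d l s)) (hB : Algebra.FiniteType ℂ B)
    (hirr : LieModule.IsIrreducible ℂ (B ⊗[ℂ] τ) V) (s : Fin n → ℤ) :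
    ∃ N : ℕ, ∀ t, N < Module.finrank ℂ (wt B V d l t) → (((n : ℤ) + 1) • (s - t) + 1) ≠ 0 ∧
      ∀ v : V, EventuallyKills P B (((n : ℤ) + 1) • (s - t) + 1) v := by
  obtain ⟨N, hN⟩ := hP.exists_eventuallyKills hn hfd hB hirr (l := l) s
  let box : Finset (Fin n → ℤ) := Finset.Icc (s - fun _ => 3) (s + fun _ => 3)
  refine ⟨N + ∑ t ∈ box, Module.finrank ℂ (wt B V d l t), fun t ht => ?_⟩
  have hex : ∃ p, 3 ≤ |(s - t) p| := by
    by_contra! hall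
    have hbox : t ∈ box := by
      rw [Finset.mem_Icc]
      constructor <;> intro p <;> have := abs_lt.mp (hall p) <;>
        simp only [Pi.sub_apply, Pi.add_apply] at this ⊢ <;> omega
    have := Finset.single_le_sum (f := fun t => Module.finrank ℂ (wt B V d l t))
      (fun _ _ => Nat.zero_le _) hbox
    omega
  refine ⟨fun h0 => ?_, hN t hex (by omega)⟩
  obtain ⟨p, hp⟩ := hex
  have := congrFun h0 p
  simp only [Pi.add_apply, Pi.smul_apply, smul_eq_mul, Pi.one_apply, Pi.zero_apply] at this
  rcases le_abs.mp hp with h | h <;> nlinarith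

/-- If all weights missing in the coset lie in a half space, then the dimensions of the weight
spaces are bounded on every smaller half space. -/
lemma IsDegreeGrading.exists_finrank_le (hn : 0 < n) (hP : IsDegreeGrading P d γ)
    (hfd : ∀ s, FiniteDimensional ℂ (wt B V d l s)) (hB : Algebra.FiniteType ℂ B)
    (hirr : LieModule.IsIrreducible ℂ (B ⊗[ℂ] τ) V) {h : (Fin n → ℤ) →+ ℝ} {s₀ : Fin n → ℤ}
    (hh : ∀ t, wt B V d l t = ⊥ → h s₀ ≤ h t) (s : Fin n → ℤ) :
    ∃ D : ℕ, ∀ t, h s + h 1 / (n + 1) < h t → Module.finrank ℂ (wt B V d l t) ≤ D := by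
  obtain ⟨N, hN⟩ := hP.exists_bound_eventuallyKills hn hfd hB hirr (l := l) s
  refine ⟨N, fun t ht => ?_⟩
  by_contra! hlt
  obtain ⟨hσ, hev⟩ := hN t hlt
  obtain ⟨x, hx, hx0⟩ := ((hP.eventually_wt_eq_bot (l := l) hfd hσ hev s₀).and
    (Filter.eventually_gt_atTop 0)).exists
  have h1 := hh _ hx
  rw [map_add, map_zsmul, map_add, map_zsmul, map_sub] at h1
  have hx0' : (0 : ℝ) < x := by exact_mod_cast hx0
  have hn' : (0 : ℝ) < n + 1 := by positivity
  have h2 : h 1 < (n + 1) * (h t - h s) := by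
    have : h 1 / (n + 1) < h t - h s := by linarith
    rwa [div_lt_iff₀ hn', mul_comm] at this
  simp only [zsmul_eq_mul] at h1
  push_cast at h1
  nlinarith

lemma exists_last {p : ℤ → Prop} (h0 : p 0) (h : ∀ᶠ x : ℤ in Filter.atTop, ¬ p x) :
    ∃ y, 0 ≤ y ∧ p y ∧ ∀ x, 0 < x → ¬ p (y + x) := by
  obtain ⟨N, hN⟩ := Filter.eventually_atTop.mp h
  obtain ⟨y, hy, hmax⟩ := Int.exists_greatest_of_bdd (P := p)
    ⟨N, fun z hz => by by_contra! hlt; exact hN z hlt.le hz⟩ ⟨0, h0⟩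
  exact ⟨y, hmax 0 h0, hy, fun x hx hp => by have := hmax _ hp; omega⟩

/-- Strings of weights in a direction `q` in which the dimensions stay bounded cannot all be
finite. -/
lemma IsDegreeGrading.not_eventually_wt_eq_bot (hn : 2 ≤ n) (hP : IsDegreeGrading P d γ)
    (hirr : LieModule.IsIrreducible ℂ (B ⊗[ℂ] τ) V)
    (hfd : ∀ s, FiniteDimensional ℂ (wt B V d l s))
    (hunb : ∀ N : ℕ, ∃ t, N < Module.finrank ℂ (wt B V d l t)) {σ : Fin n → ℤ}
    (hσ : σ ≠ 0) (hev : ∀ v : V, EventuallyKills P B σ v) {h : (Fin n → ℤ) →+ ℝ} (hhσ : h σ = 1)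
    {η : ℝ} {D : ℕ} (hD : ∀ t, η < h t → Module.finrank ℂ (wt B V d l t) ≤ D)
    {s : Fin n → ℤ} (hs : wt B V d l s ≠ ⊥) {q : Fin n → ℤ} (hq : q ≠ 0) (hhq : 0 ≤ h q)
    (hbig : η < h s - 1 - ∑ i, |h (Pi.single i 1)| - (2 * D + 4) * h q)
    (hray : ∀ t, wt B V d l t ≠ ⊥ → ∀ᶠ x : ℤ in Filter.atTop, wt B V d l (t + x • q) = ⊥) :
    False := by
  have hprop : ∀ t, wt B V d l t ≠ ⊥ → h s - 1 - ∑ i, |h (Pi.single i 1)| ≤ h t →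
      ∀ a b, (q a : ℂ) * (l b + t b) = q b * (l a + t a) := by
    intro t ht hht a b
    obtain ⟨y, hy, hyt, hlast⟩ := exists_last (p := fun x => wt B V d l (t + x • q) ≠ ⊥)
      (by simpa using ht) (by simpa using hray t ht)
    have hsum : ∀ f : Fin n → ℂ, ∑ i, (Pi.single b (q a : ℂ) - Pi.single a (q b : ℂ) :
        Fin n → ℂ) i * f i = q a * f b - q b * f a := fun f => by
      simp [sub_mul, Finset.sum_sub_distrib, Pi.single_apply, ite_mul]
    by_contra hne
    have hK := hP.le_finrank_wt hfd hq
      (w := Pi.single b (q a : ℂ) - Pi.single a (q b : ℂ)) (by rw [hsum]; ring) hyt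
      (fun x hx => by
        have := hlast x hx
        rw [not_not, add_smul, ← add_assoc] at this
        exact this)
      (by
        rw [hsum]
        intro h0
        apply hne
        simp only [Pi.add_apply, Pi.smul_apply, smul_eq_mul] at h0
        push_cast at h0
        linear_combination h0) (D + 1)
    have hle := hD (t + y • q - (2 * (D + 1 : ℕ) + 2 : ℤ) • q) (by
      rw [map_sub, map_add, map_zsmul, map_zsmul, zsmul_eq_mul, zsmul_eq_mul]
      have : (0 : ℝ) ≤ y * h q := mul_nonneg (by exact_mod_cast hy) hhq
      push_cast
      linarith)
    omega
  obtain ⟨p, hp⟩ := Function.ne_iff.mp hσ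
  have : Nontrivial (Fin n) := Fin.nontrivial_iff_two_le.mpr hn
  obtain ⟨j, hj⟩ := exists_ne p
  have hsingle : |h (Pi.single j 1)| ≤ ∑ i, |h (Pi.single i 1)| :=
    Finset.single_le_sum (f := fun i => |h (Pi.single i 1)|) (fun i _ => abs_nonneg _)
      (Finset.mem_univ j)
  obtain ⟨e, he, hej, hhe⟩ : ∃ e : Fin n → ℤ, wt B V d l (s + (e - σ)) ≠ ⊥ ∧
      (∃ c : ℤ, c ≠ 0 ∧ e = Pi.single j c) ∧ -|h (Pi.single j 1)| ≤ h e := by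
    rcases hP.wt_add_sub_ne_bot_or hn hirr hfd hunb hσ hev hs (Pi.single j 1) with h1 | h1
    · exact ⟨_, h1, ⟨1, one_ne_zero, rfl⟩, neg_abs_le _⟩
    · refine ⟨_, h1, ⟨-1, by decide, by rw [Pi.single_neg]⟩, ?_⟩
      rw [map_neg]
      exact neg_le_neg (le_abs_self _)
  obtain ⟨c, hc, rfl⟩ := hej
  have hnn : 0 ≤ ∑ i, |h (Pi.single i 1)| := Finset.sum_nonneg fun i _ => abs_nonneg _
  have h1 := hprop s hs (by linarith)
  have h2 := hprop (s - σ) (hP.wt_sub_ne_bot hn hirr hfd hunb hσ hev hs) (by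
    rw [map_sub, hhσ]; linarith)
  have h3 := hprop _ he (by rw [map_add, map_sub, hhσ]; linarith)
  have h4 : ∀ a b, q a * σ b = q b * σ a := fun a b => by
    have h1 := h1 a b
    have h2 := h2 a b
    simp only [Pi.sub_apply] at h2
    push_cast at h2
    have : (q a : ℂ) * σ b = q b * σ a := by linear_combination h1 - h2
    exact_mod_cast this
  have h5 : ∀ a b, q a * (Pi.single j c : Fin n → ℤ) b = q b * (Pi.single j c : Fin n → ℤ) a :=
    fun a b => by
    have h2 := h2 a b
    have h3 := h3 a b
    simp only [Pi.sub_apply, Pi.add_apply] at h2 h3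
    push_cast at h2 h3
    have : (q a : ℂ) * ((Pi.single j c : Fin n → ℤ) b : ℤ) =
      q b * ((Pi.single j c : Fin n → ℤ) a : ℤ) := by linear_combination h3 - h2
    exact_mod_cast this
  have h6 : ∀ a, a ≠ j → q a = 0 := fun a ha => by
    have := h5 a j
    rw [Pi.single_eq_same, Pi.single_eq_of_ne ha, mul_zero] at this
    exact (mul_eq_zero.mp this).resolve_right hc
  have h7 : q j = 0 := by
    have := h4 j p
    rw [h6 p hj.symm, zero_mul] at this
    exact (mul_eq_zero.mp this).resolve_right hp
  apply hq
  ext a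
  by_cases ha : a = j
  · rw [ha, h7]; rfl
  · exact h6 a ha

/-- An irreducible module with finite-dimensional weight spaces of unbounded dimension has a
highest weight vector. -/
theorem IsDegreeGrading.exists_highest_weight_vector (hn : 2 ≤ n) (hP : IsDegreeGrading P d γ)
    (hirr : LieModule.IsIrreducible ℂ (B ⊗[ℂ] τ) V)
    (hfd : ∀ s, FiniteDimensional ℂ (wt B V d l s))
    (hunb : ∀ N : ℕ, ∃ t, N < Module.finrank ℂ (wt B V d l t)) (hB : Algebra.FiniteType ℂ B) :
    ∃ (M : AddSubgroup (Fin n → ℤ)) (β : Fin n → ℤ), IsCompl M (AddSubgroup.zmultiples β) ∧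
      ∃ v : V, v ≠ 0 ∧ ∀ m ∈ M, ∀ r : ℕ, 0 < r → ∀ b : B, Kills P b (m + (r : ℤ) • β) v := by
  have hn0 : 0 < n := by omega
  obtain ⟨N, hN⟩ := hP.exists_bound_eventuallyKills hn0 hfd hB hirr (l := l) 0
  obtain ⟨t₀, ht₀⟩ := hunb N
  obtain ⟨hσ, hev⟩ := hN t₀ ht₀
  generalize ((n : ℤ) + 1) • (0 - t₀) + 1 = σ at hσ hev
  obtain ⟨s₀, hs₀⟩ : ∃ s, wt B V d l s ≠ ⊥ := ⟨t₀, fun h0 => by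
    rw [h0, finrank_bot] at ht₀
    omega⟩
  obtain ⟨h, hhσ, hh⟩ := exists_addMonoidHom_nonneg hσ
    (fun x hx => hP.neg_notMem_closure_killSet hn hirr hfd hunb hσ hev hs₀ hx)
    (fun j => hP.eventually_mem_killSet hσ hev s₀ j)
  have hT : ∀ t, wt B V d l t = ⊥ → h s₀ ≤ h t := fun t ht => by
    have := hh (t - s₀) (hP.mem_killSet_of_wt_eq_bot (by rwa [add_sub_cancel]))
    rw [map_sub] at this
    linarith
  by_cases hbdd : ∃ C : ℝ, ∀ s, wt B V d l s ≠ ⊥ → h s ≤ C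
  · obtain ⟨C, hC⟩ := hbdd
    rcases AddSubgroup.dense_or_cyclic h.range with hdense | ⟨a, ha⟩
    · exfalso
      obtain ⟨y, hy⟩ := exists_nat_gt (h 1 / (n + 1) + 2 + ∑ i, |h (Pi.single i 1)|)
      obtain ⟨D, hD⟩ := hP.exists_finrank_le hn0 hfd hB hirr hT (s₀ - (y : ℤ) • σ)
      have hpos : (0 : ℝ) < 2 * D + 4 := by positivity
      obtain ⟨_, ⟨q, rfl⟩, hq0, hq1⟩ := hdense.exists_between (div_pos one_pos hpos)
      rw [lt_div_iff₀ hpos] at hq1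
      refine hP.not_eventually_wt_eq_bot hn hirr hfd hunb hσ hev hhσ hD hs₀ (q := q)
        (fun h0 => by simp [h0] at hq0) hq0.le ?_ fun t ht => ?_
      · rw [map_sub, map_zsmul, hhσ]
        simp only [zsmul_eq_mul]
        push_cast
        linarith
      · obtain ⟨x₀, hx₀⟩ := exists_int_gt ((C - h t) / h q)
        filter_upwards [Filter.eventually_ge_atTop x₀] with x hx
        by_contra hne
        have h1 := hC _ hne
        rw [map_add, map_zsmul, zsmul_eq_mul] at h1
        rw [div_lt_iff₀ hq0] at hx₀
        have hx' : (x₀ : ℝ) ≤ x := by exact_mod_cast hx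
        nlinarith
    · obtain ⟨a, ha0, hmem⟩ : ∃ a : ℝ, 0 < a ∧ ∀ r, r ∈ h.range ↔ ∃ k : ℤ, k * a = r := by
        have hmem : ∀ r, r ∈ h.range ↔ ∃ k : ℤ, k * a = r := fun r => by
          rw [ha, AddSubgroup.mem_closure_singleton]
          simp
        rcases lt_trichotomy a 0 with hlt | rfl | hgt
        · refine ⟨-a, neg_pos.mpr hlt, fun r => (hmem r).trans ⟨?_, ?_⟩⟩ <;>
          · rintro ⟨k, rfl⟩
            exact ⟨-k, by push_cast; ring⟩
        · obtain ⟨k, hk⟩ := (hmem 1).mp ⟨σ, hhσ⟩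
          simp at hk
        · exact ⟨a, hgt, hmem⟩
      obtain ⟨β, hβ⟩ := (hmem a).mpr ⟨1, by simp⟩
      obtain ⟨k, ⟨s, hs, hks⟩, hmax⟩ := Int.exists_greatest_of_bdd
        (P := fun k : ℤ => ∃ s, wt B V d l s ≠ ⊥ ∧ k * a = h s) (by
          refine ⟨⌈C / a⌉, fun z ⟨s, hs, hz⟩ => ?_⟩
          have h1 := hC s hs
          rw [← hz, ← le_div_iff₀ ha0] at h1
          exact_mod_cast h1.trans (Int.le_ceil _)) (by
          obtain ⟨k, hk⟩ := (hmem (h s₀)).mp ⟨s₀, rfl⟩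
          exact ⟨k, s₀, hs₀, hk⟩)
      obtain ⟨v, hv, hv0⟩ := Submodule.exists_mem_ne_zero_of_ne_bot hs
      refine ⟨h.ker, β, ?_, v, hv0, fun m hm r hr b X hX => ?_⟩
      · rw [isCompl_iff, disjoint_iff, codisjoint_iff]
        constructor
        · rw [eq_bot_iff]
          rintro x ⟨hx1, hx2⟩
          obtain ⟨c, rfl⟩ := AddSubgroup.mem_zmultiples_iff.mp hx2
          have : h (c • β) = 0 := hx1
          rw [map_zsmul, hβ, zsmul_eq_mul, mul_eq_zero, or_iff_left ha0.ne'] at this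
          have hc : c = 0 := by exact_mod_cast this
          rw [hc, zero_smul]
          exact zero_mem _
        · rw [eq_top_iff]
          intro x _
          obtain ⟨c, hc⟩ := (hmem (h x)).mp ⟨x, rfl⟩
          rw [AddSubgroup.mem_sup]
          refine ⟨x - c • β, ?_, c • β, AddSubgroup.zsmul_mem_zmultiples β c, sub_add_cancel _ _⟩
          rw [AddMonoidHom.mem_ker, map_sub, map_zsmul, hβ, zsmul_eq_mul, hc, sub_self]
      · have h1 := hP.lie_mem_wt hX b hv
        have h2 : wt B V d l (s + (m + (r : ℤ) • β)) = ⊥ := by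
          by_contra hne
          have := hmax (k + r) ⟨_, hne, by
            rw [map_add, map_add, map_zsmul, hβ, (AddMonoidHom.mem_ker).mp hm, ← hks,
              zsmul_eq_mul]
            push_cast
            ring⟩
          omega
        rwa [h2, Submodule.mem_bot] at h1
  · exfalso
    push Not at hbdd
    obtain ⟨D, hD⟩ := hP.exists_finrank_le hn0 hfd hB hirr hT 0
    obtain ⟨s, hs, hs'⟩ := hbdd (h 0 + h 1 / (n + 1) + 1 + ∑ i, |h (Pi.single i 1)| + (2 * D + 4))
    exact hP.not_eventually_wt_eq_bot hn hirr hfd hunb hσ hev hhσ hD hs hσ (by rw [hhσ]; norm_num)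
      (by rw [hhσ]; linarith) fun t _ => hP.eventually_wt_eq_bot hfd hσ hev t

end HighestWeight

section Toroidal

variable {κ : 𝔤 →ₗ[ℂ] 𝔤 →ₗ[ℂ] ℂ} {c₁ c₂ : ℂ} {E : (Fin n → ℤ) → 𝔤 →ₗ[ℂ] τ}
  {K W : (Fin n → ℤ) → Fin n → τ}

/-- The pairing between `ℂⁿ` and `ℤⁿ`. -/
def pair (u : Fin n → ℂ) (k : Fin n → ℤ) : ℂ := ∑ i, u i * (k i : ℂ)

lemma exists_pair_eq_one {k : Fin n → ℤ} (hk : k ≠ 0) : ∃ u, pair u k = 1 := by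
  obtain ⟨i, hi⟩ := Function.ne_iff.mp hk
  have hi' : (k i : ℂ) ≠ 0 := by exact_mod_cast hi
  exact ⟨Pi.single i (k i : ℂ)⁻¹, by simp [pair, Pi.single_apply, ite_mul, hi']⟩

lemma IsFullToroidal.lie_sum_W_E (hτ : IsFullToroidal n 𝔤 τ κ c₁ c₂ E K W) (m k : Fin n → ℤ)
    (u : Fin n → ℂ) (x : 𝔤) : ⁅∑ i, u i • W m i, E k x⁆ = pair u k • E (m + k) x := by
  simp only [sum_lie, smul_lie, hτ.lie_W_E, smul_smul, pair, Finset.sum_smul]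

lemma IsFullToroidal.lie_sum_W_K (hτ : IsFullToroidal n 𝔤 τ κ c₁ c₂ E K W) (m k : Fin n → ℤ)
    (u : Fin n → ℂ) (j : Fin n) : ⁅∑ i, u i • W m i, K k j⁆ =
      pair u k • K (m + k) j + u j • ∑ p, (m p : ℂ) • K (m + k) p := by
  simp only [sum_lie, smul_lie, hτ.lie_W_K, smul_add, smul_smul, Finset.sum_add_distrib, pair,
    Finset.sum_smul, smul_ite, smul_zero, Finset.sum_ite_eq', Finset.mem_univ, if_true]

lemma IsFullToroidal.lie_sum_W_sum_W (hτ : IsFullToroidal n 𝔤 τ κ c₁ c₂ E K W) (m k : Fin n → ℤ)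
    (u w : Fin n → ℂ) : ⁅∑ i, u i • W m i, ∑ i, w i • W k i⁆ =
      pair u k • ∑ i, w i • W (m + k) i - pair w m • ∑ i, u i • W (m + k) i +
        (c₁ * (-(pair u k * pair w m)) + c₂ * (pair u m * pair w k)) •
          ∑ p, (m p : ℂ) • K (m + k) p := by
  generalize hZ : ∑ p, (m p : ℂ) • K (m + k) p = Z
  have hexp : ⁅∑ i, u i • W m i, ∑ i, w i • W k i⁆ =
      ∑ i, ∑ j, (u i * w j) • ⁅W m i, W k j⁆ := by
    simp only [sum_lie, lie_sum, smul_lie, lie_smul, smul_smul, Finset.smul_sum]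
    rw [Finset.sum_comm]
    simp only [mul_comm]
  simp only [hexp, hτ.lie_W_W, hZ, smul_add, smul_sub, smul_smul,
    Finset.sum_add_distrib, Finset.sum_sub_distrib, Finset.smul_sum]
  congr 1
  · congr 1
    · rw [Finset.sum_comm]
      refine Finset.sum_congr rfl fun j _ => ?_
      rw [pair, ← Finset.sum_smul, Finset.sum_mul]
      exact congrArg (· • W (m + k) j) (Finset.sum_congr rfl fun i _ => by ring)
    · refine Finset.sum_congr rfl fun j _ => ?_
      rw [pair, ← Finset.sum_smul, Finset.sum_mul]
      exact congrArg (· • W (m + k) j) (Finset.sum_congr rfl fun i _ => by ring)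
  · simp only [← Finset.sum_smul]
    congr 1
    simp only [pair, Finset.sum_mul_sum]
    simp only [Finset.mul_sum, ← Finset.sum_neg_distrib, ← Finset.sum_add_distrib]
    refine Finset.sum_congr rfl fun i _ => Finset.sum_congr rfl fun j _ => ?_
    ring

lemma E_mem_gradedPiece (m : Fin n → ℤ) (x : 𝔤) : E m x ∈ gradedPiece E K W m :=
  Submodule.subset_span (Or.inl (Or.inl ⟨x, rfl⟩))

lemma K_mem_gradedPiece (m : Fin n → ℤ) (i : Fin n) : K m i ∈ gradedPiece E K W m :=
  Submodule.subset_span (Or.inl (Or.inr ⟨i, rfl⟩))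

lemma W_mem_gradedPiece (m : Fin n → ℤ) (i : Fin n) : W m i ∈ gradedPiece E K W m :=
  Submodule.subset_span (Or.inr ⟨i, rfl⟩)

lemma sum_K_mem_gradedPiece (m : Fin n → ℤ) (u : Fin n → ℂ) :
    ∑ i, u i • K m i ∈ gradedPiece E K W m :=
  sum_mem fun i _ => Submodule.smul_mem _ _ (K_mem_gradedPiece m i)

lemma sum_W_mem_gradedPiece (m : Fin n → ℤ) (u : Fin n → ℂ) :
    ∑ i, u i • W m i ∈ gradedPiece E K W m :=
  sum_mem fun i _ => Submodule.smul_mem _ _ (W_mem_gradedPiece m i)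

lemma gradedPiece_le {m : Fin n → ℤ} {N : Submodule ℂ τ} (hE : ∀ x, E m x ∈ N)
    (hK : ∀ i, K m i ∈ N) (hW : ∀ i, W m i ∈ N) : gradedPiece E K W m ≤ N := by
  refine Submodule.span_le.mpr ?_
  rintro _ ((⟨x, rfl⟩ | ⟨i, rfl⟩) | ⟨i, rfl⟩)
  exacts [hE x, hK i, hW i]

lemma IsFullToroidal.lie_mem_gradedPiece (hτ : IsFullToroidal n 𝔤 τ κ c₁ c₂ E K W)
    (m k : Fin n → ℤ) {X Y : τ} (hX : X ∈ gradedPiece E K W m) (hY : Y ∈ gradedPiece E K W k) :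
    ⁅X, Y⁆ ∈ gradedPiece E K W (m + k) := by
  have hEK : ∀ m k x j, ⁅E m x, K k j⁆ ∈ gradedPiece E K W (m + k) := fun m k x j => by
    rw [hτ.lie_E_K]
    exact zero_mem _
  have hWE : ∀ m k i x, ⁅W m i, E k x⁆ ∈ gradedPiece E K W (m + k) := fun m k i x => by
    rw [hτ.lie_W_E]
    exact Submodule.smul_mem _ _ (E_mem_gradedPiece _ _)
  have hWK : ∀ m k i j, ⁅W m i, K k j⁆ ∈ gradedPiece E K W (m + k) := fun m k i j => by
    rw [hτ.lie_W_K]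
    refine add_mem (Submodule.smul_mem _ _ (K_mem_gradedPiece _ _)) ?_
    split_ifs
    exacts [sum_K_mem_gradedPiece _ _, zero_mem _]
  have hswap : ∀ {X Y : τ} {m k : Fin n → ℤ}, ⁅X, Y⁆ ∈ gradedPiece E K W (m + k) →
      ⁅Y, X⁆ ∈ gradedPiece E K W (k + m) := fun h => by
    rw [← lie_skew, add_comm]
    exact neg_mem h
  have hbr : ∀ Z : τ, gradedPiece E K W k ≤
      (gradedPiece E K W (m + k)).comap (LieAlgebra.ad ℂ τ Z : τ →ₗ[ℂ] τ) ↔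
      ∀ Y ∈ gradedPiece E K W k, ⁅Z, Y⁆ ∈ gradedPiece E K W (m + k) := fun Z => Iff.rfl
  have hleft : gradedPiece E K W m ≤
      (gradedPiece E K W (m + k)).comap (LieAlgebra.ad ℂ τ Y : τ →ₗ[ℂ] τ) := by
    refine gradedPiece_le (fun x => ?_) (fun i => ?_) (fun i => ?_) <;>
      rw [Submodule.mem_comap, LieAlgebra.ad_apply, add_comm] <;> apply hswap <;>
      refine (hbr _).mp (gradedPiece_le (fun y => ?_) (fun j => ?_) (fun j => ?_)) Y hY <;>
      rw [Submodule.mem_comap, LieAlgebra.ad_apply]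
    · rw [hτ.lie_E_E]
      exact add_mem (E_mem_gradedPiece _ _)
        (Submodule.smul_mem _ _ (sum_K_mem_gradedPiece _ _))
    · exact hEK _ _ _ _
    · exact hswap (hWE _ _ _ _)
    · exact hswap (hEK _ _ _ _)
    · rw [hτ.lie_K_K]
      exact zero_mem _
    · exact hswap (hWK _ _ _ _)
    · exact hWE _ _ _ _
    · exact hWK _ _ _ _
    · rw [hτ.lie_W_W]
      exact add_mem (sub_mem (Submodule.smul_mem _ _ (W_mem_gradedPiece _ _))
        (Submodule.smul_mem _ _ (W_mem_gradedPiece _ _)))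
        (Submodule.smul_mem _ _ (sum_K_mem_gradedPiece _ _))
  rw [← lie_skew]
  exact neg_mem (hleft hX)

lemma IsFullToroidal.gradedPiece_le_span_lie [Nontrivial 𝔤]
    (hτ : IsFullToroidal n 𝔤 τ κ c₁ c₂ E K W) {m k : Fin n → ℤ} (hmk : m ≠ k) (hk : k ≠ 0) :
    gradedPiece E K W (m + k) ≤ Submodule.span ℂ
      {Z | ∃ X ∈ gradedPiece E K W m, ∃ Y ∈ gradedPiece E K W k, Z = ⁅X, Y⁆} := by
  set S := Submodule.span ℂ
    {Z | ∃ X ∈ gradedPiece E K W m, ∃ Y ∈ gradedPiece E K W k, Z = ⁅X, Y⁆}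
  have hS : ∀ X ∈ gradedPiece E K W m, ∀ Y ∈ gradedPiece E K W k, ⁅X, Y⁆ ∈ S :=
    fun X hX Y hY => Submodule.subset_span ⟨X, hX, Y, hY, rfl⟩
  obtain ⟨u, hu⟩ := exists_pair_eq_one hk
  have hE : ∀ x, E (m + k) x ∈ S := fun x => by
    have := hS _ (sum_W_mem_gradedPiece m u) _ (E_mem_gradedPiece k x)
    rwa [hτ.lie_sum_W_E, hu, one_smul] at this
  have hKm : ∑ p, (m p : ℂ) • K (m + k) p ∈ S := by
    obtain ⟨x, hx⟩ := exists_ne (0 : 𝔤)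
    obtain ⟨y, hy⟩ := not_forall.mp (mt (hτ.κ_nondeg x) hx)
    have := hS _ (E_mem_gradedPiece m x) _ (E_mem_gradedPiece k y)
    rw [hτ.lie_E_E, Submodule.add_mem_iff_right _ (hE _)] at this
    exact (Submodule.smul_mem_iff _ hy).mp this
  have hW : ∀ z : Fin n → ℂ, pair z (k - m) ≠ 0 → ∑ i, z i • W (m + k) i ∈ S := fun z hz => by
    have := hS _ (sum_W_mem_gradedPiece m z) _ (sum_W_mem_gradedPiece k z)
    rw [hτ.lie_sum_W_sum_W, Submodule.add_mem_iff_left _ (Submodule.smul_mem _ _ hKm),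
      ← sub_smul] at this
    refine (Submodule.smul_mem_iff _ ?_).mp this
    convert hz using 1
    simp [pair, mul_sub, Finset.sum_sub_distrib]
  refine gradedPiece_le hE (fun i => ?_) (fun i => ?_)
  · have := hS _ (sum_W_mem_gradedPiece m u) _ (K_mem_gradedPiece k i)
    rwa [hτ.lie_sum_W_K, hu, one_smul,
      Submodule.add_mem_iff_left _ (Submodule.smul_mem _ _ hKm)] at this
  · have hi : ∑ j, (Pi.single i 1 : Fin n → ℂ) j • W (m + k) j = W (m + k) i := by
      simp [Pi.single_apply, ite_smul]
    by_cases h0 : pair (Pi.single i 1) (k - m) = 0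
    · obtain ⟨z, hz⟩ := exists_pair_eq_one (sub_ne_zero.mpr hmk.symm)
      have hadd : pair (Pi.single i 1 + z) (k - m) = 1 := by
        rw [pair] at h0 hz ⊢
        simp only [Pi.add_apply, add_mul, Finset.sum_add_distrib, h0, hz, zero_add]
      have := hW _ (hadd ▸ one_ne_zero)
      simp only [Pi.add_apply, add_smul, Finset.sum_add_distrib] at this
      rwa [hi, Submodule.add_mem_iff_left _ (hW z (hz ▸ one_ne_zero))] at this
    · rw [← hi]
      exact hW _ h0

lemma IsFullToroidal.isDegreeGrading [Nontrivial 𝔤] [FiniteDimensional ℂ 𝔤]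
    (hτ : IsFullToroidal n 𝔤 τ κ c₁ c₂ E K W) :
    ∃ γ, IsDegreeGrading (gradedPiece E K W) (W 0) γ := by
  let b := Module.finBasis ℂ 𝔤
  let ι := Fin (Module.finrank ℂ 𝔤) ⊕ Fin n ⊕ Fin n
  refine ⟨Fintype.card ι, fun m k X Y => hτ.lie_mem_gradedPiece m k, fun m k hmk => ?_, ?_,
    W_mem_gradedPiece 0, fun i k => ?_, fun k => ?_, fun q hq w hw => ?_⟩
  · by_cases hk : k = 0
    · have := hτ.gradedPiece_le_span_lie hmk.symm (hk ▸ hmk)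
      rw [add_comm]
      refine this.trans (Submodule.span_le.mpr ?_)
      rintro _ ⟨X, hX, Y, hY, rfl⟩
      rw [← lie_skew]
      exact neg_mem (Submodule.subset_span ⟨Y, hY, X, hX, rfl⟩)
    · exact hτ.gradedPiece_le_span_lie hmk hk
  · rw [eq_top_iff, ← hτ.span_eq_top, Submodule.span_le]
    rintro _ ((⟨m, x, rfl⟩ | ⟨m, i, rfl⟩) | ⟨m, i, rfl⟩)
    exacts [Submodule.mem_iSup_of_mem m (E_mem_gradedPiece m x),
      Submodule.mem_iSup_of_mem m (K_mem_gradedPiece m i),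
      Submodule.mem_iSup_of_mem m (W_mem_gradedPiece m i)]
  · have : gradedPiece E K W k ≤ LinearMap.ker
        ((LieAlgebra.ad ℂ τ (W 0 i) : τ →ₗ[ℂ] τ) - (k i : ℂ) • LinearMap.id) := by
      refine gradedPiece_le (fun x => ?_) (fun j => ?_) (fun j => ?_) <;>
        simp [hτ.lie_W_E, hτ.lie_W_K, hτ.lie_W_W]
    intro X hX
    simpa [sub_eq_zero] using this hX
  · let f : ι → τ := Sum.elim (fun j => E k (b j)) (Sum.elim (K k) (W k))
    refine ⟨f ∘ (Fintype.equivFin ι).symm, ?_⟩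
    rw [(Fintype.equivFin ι).symm.surjective.range_comp]
    apply le_antisymm
    · rw [Submodule.span_le]
      rintro _ ⟨j | j | j, rfl⟩
      exacts [E_mem_gradedPiece k _, K_mem_gradedPiece k j, W_mem_gradedPiece k j]
    · refine gradedPiece_le (fun x => ?_)
        (fun j => Submodule.subset_span ⟨Sum.inr (Sum.inl j), rfl⟩)
        (fun j => Submodule.subset_span ⟨Sum.inr (Sum.inr j), rfl⟩)
      rw [← b.sum_repr x, map_sum]
      refine sum_mem fun j _ => ?_
      rw [map_smul]
      exact Submodule.smul_mem _ _ (Submodule.subset_span ⟨Sum.inl j, rfl⟩)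
  · obtain ⟨u, hu⟩ := exists_pair_eq_one hq
    have hsmul : ∀ (v : Fin n → ℂ) (x : ℤ), pair v (x • q) = x * pair v q := fun v x => by
      simp only [pair, Pi.smul_apply, smul_eq_mul, Finset.mul_sum]
      exact Finset.sum_congr rfl fun i _ => by push_cast; ring
    have hw' : pair w q = 0 := hw
    refine ⟨fun x => ∑ i, u i • W (x • q) i, fun x => ∑ i, w i • W (x • q) i,
      fun x => sum_W_mem_gradedPiece _ _, fun x => sum_W_mem_gradedPiece _ _, fun x y => ?_,
      fun x y => ?_, ?_⟩
    · rw [hτ.lie_sum_W_sum_W, hsmul, hsmul, hsmul, hsmul, hw', hu, ← add_smul]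
      simp
    · rw [hτ.lie_sum_W_sum_W, hsmul, hsmul, hw']
      simp
    · simp only [zero_smul]

end Toroidal

theorem statement_2
    (n : ℕ) (hn : 3 ≤ n)
    (𝔤 : Type) [LieRing 𝔤] [LieAlgebra ℂ 𝔤] [LieAlgebra.IsSimple ℂ 𝔤]
    [FiniteDimensional ℂ 𝔤]
    (τ : Type) [LieRing τ] [LieAlgebra ℂ τ]
    (κ : 𝔤 →ₗ[ℂ] 𝔤 →ₗ[ℂ] ℂ) (c₁ c₂ : ℂ)
    (E : (Fin n → ℤ) → 𝔤 →ₗ[ℂ] τ) (K W : (Fin n → ℤ) → Fin n → τ)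
    (hτ : IsFullToroidal n 𝔤 τ κ c₁ c₂ E K W)
    (B : Type) [CommRing B] [Algebra ℂ B] [Nontrivial B]
    (hB : Algebra.FiniteType ℂ B)
    (V : Type) [AddCommGroup V] [Module ℂ V]
    [LieRingModule (B ⊗[ℂ] τ) V] [LieModule ℂ (B ⊗[ℂ] τ) V]
    (hirr : LieModule.IsIrreducible ℂ (B ⊗[ℂ] τ) V)
    (hHC : IsHarishChandra (V := V) (dOp B W))
    (hnb : ¬ ∃ N : ℕ, ∀ l : Fin n → ℂ,
      Module.finrank ℂ (weightSpace (V := V) (dOp B W) l) ≤ N) :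
    IsHighestWeightModule B E K W V := by
  have : Nontrivial 𝔤 := by
    by_contra h
    have := not_nontrivial_iff_subsingleton.mp h
    exact LieAlgebra.IsSimple.non_abelian ℂ (L := 𝔤) ⟨fun x y => Subsingleton.elim _ _⟩
  obtain ⟨γ, hP⟩ := hτ.isDegreeGrading
  push Not at hnb
  have hne : ∀ {N : ℕ} {l : Fin n → ℂ}, N < Module.finrank ℂ (weightSpace (V := V) (dOp B W) l) →
      weightSpace (V := V) (dOp B W) l ≠ ⊥ := fun h h0 => by
    rw [h0, finrank_bot] at h
    exact Nat.not_lt_zero _ h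
  obtain ⟨l, hl⟩ := hnb 0
  have hl0 : wt B V (W 0) l 0 ≠ ⊥ := by
    convert hne hl using 1
    simp only [wt, Pi.zero_apply, Int.cast_zero, add_zero]
    rfl
  have hunb : ∀ N : ℕ, ∃ t, N < Module.finrank ℂ (wt B V (W 0) l t) := fun N => by
    obtain ⟨l', hl'⟩ := hnb N
    obtain ⟨t, rfl⟩ := hP.exists_eq_add_of_weightSpace_ne_bot hirr hl0 (hne hl')
    exact ⟨t, hl'⟩
  obtain ⟨M, β, hMβ, v, hv, hkill⟩ :=
    hP.exists_highest_weight_vector (by omega) hirr (fun s => hHC.2 _) hunb hB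
  refine ⟨M, β, hMβ, v, hv, fun m hm r hr b => ?_, ?_⟩
  · have h := hkill m hm r hr b
    exact ⟨fun x => h _ (E_mem_gradedPiece _ x), fun i => h _ (K_mem_gradedPiece _ i),
      fun i => h _ (W_mem_gradedPiece _ i)⟩
  · refine (eq_bot_or_eq_top _).resolve_left fun h => hv ?_
    have hmem : v ∈ LieSubmodule.lieSpan ℂ (B ⊗[ℂ] τ) {v} := LieSubmodule.subset_lieSpan rfl
    rwa [h, LieSubmodule.mem_bot] at hmem

end MT
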